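/- Theorem 2 (effective dimension of the variational approximation). For any sequence M_n > 1 with M_n → ∞, the variational approximation q^n satisfies sup_{β*} E_{β*} q^n({β ∈ R^p : |S_β| > M_n |S_{β*}|}) → 0 as n → ∞, where the supremum is over all true vectors β* in the stated high-dimensional regime with |S_{β*}| = o(n) and for which the design conditions hold. -/

import Mathlib

open MeasureTheory ProbabilityTheory Real Filter Matrix Asymptotics
open scoped ENNReal NNReal Classical Topology

noncomputable section

namespace VB

/-- The configuration (support) of a coefficient vector. -/
def config {p : ℕ} (β : Fin p → ℝ) : Finset (Fin p) :=
  Finset.univ.filter fun j => β j ≠ 0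

/-- The submatrix of `X` consisting of the columns indexed by `S`. -/
def XS {n p : ℕ} (X : Matrix (Fin n) (Fin p) ℝ) (S : Finset (Fin p)) :
    Matrix (Fin n) S ℝ := Matrix.of fun i j => X i j.1

/-- The Gram matrix `X_Sᵀ X_S`. -/
def gram {n p : ℕ} (X : Matrix (Fin n) (Fin p) ℝ) (S : Finset (Fin p)) :
    Matrix S S ℝ := (XS X S)ᵀ * XS X S

/-- The least squares estimator based on the columns in `S`:
`β̂_S = (X_Sᵀ X_S)⁻¹ X_Sᵀ y`. -/
def lse {n p : ℕ} (X : Matrix (Fin n) (Fin p) ℝ) (S : Finset (Fin p)) (y : Fin n → ℝ) :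
    S → ℝ := (gram X S)⁻¹.mulVec ((XS X S)ᵀ.mulVec y)

/-- Squared Euclidean norm of a vector. -/
def sqNorm {ι : Type*} [Fintype ι] (v : ι → ℝ) : ℝ := ∑ i, v i ^ 2

/-- Lebesgue density of the empirical conditional prior
`N(β̂_S, γ⁻¹ σ² (X_Sᵀ X_S)⁻¹)` for `β_S` given `S`. -/
def priorDens (σ2 γ : ℝ) {n p : ℕ} (X : Matrix (Fin n) (Fin p) ℝ) (S : Finset (Fin p))
    (y : Fin n → ℝ) (b : S → ℝ) : ℝ :=
  Real.sqrt ((gram X S).det * (γ / (2 * π * σ2)) ^ S.card) *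
    Real.exp (-(γ / (2 * σ2)) * ((b - lse X S y) ⬝ᵥ (gram X S).mulVec (b - lse X S y)))

/-- The `α`-power likelihood `exp{-(α/(2σ²)) ‖y - X_S β_S‖²}`. -/
def likeα (α σ2 : ℝ) {n p : ℕ} (X : Matrix (Fin n) (Fin p) ℝ) (S : Finset (Fin p))
    (y : Fin n → ℝ) (b : S → ℝ) : ℝ :=
  Real.exp (-(α / (2 * σ2)) * sqNorm (y - (XS X S).mulVec b))

/-- Unnormalized prior weight of a configuration `S`:
`binom(p,|S|)⁻¹ (c p^a)^{-|S|}` for `|S| ≤ n`, else `0`. -/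
def priorSWt (a c : ℝ) (n p : ℕ) (S : Finset (Fin p)) : ℝ :=
  if S.card ≤ n then ((p.choose S.card : ℝ) * (c * (p : ℝ) ^ a) ^ S.card)⁻¹ else 0

/-- Normalized prior probability of a configuration `S`. -/
def priorS (a c : ℝ) (n p : ℕ) (S : Finset (Fin p)) : ℝ :=
  priorSWt a c n p S / ∑ T : Finset (Fin p), priorSWt a c n p T

/-- Embed a vector indexed by `S` into `ℝ^p`, filling in zeros off `S`. -/
def embed {p : ℕ} (S : Finset (Fin p)) (b : S → ℝ) : Fin p → ℝ :=
  fun j => if h : j ∈ S then b ⟨j, h⟩ else 0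

/-- The (unnormalized) component of the empirical Bayes posterior corresponding to
configuration `S`: the measure on `ℝ^p`, supported on vectors vanishing off `S`, with
density `L_n^α(S, β_S) π_n(β_S | S)` over `β_S`. -/
def postComp (α σ2 γ : ℝ) {n p : ℕ} (X : Matrix (Fin n) (Fin p) ℝ) (y : Fin n → ℝ)
    (S : Finset (Fin p)) : Measure (Fin p → ℝ) :=
  ((volume : Measure (S → ℝ)).withDensity fun b =>
      ENNReal.ofReal (likeα α σ2 X S y b * priorDens σ2 γ X S y b)).map (embed S)

/-- The unnormalized empirical Bayes posterior on `ℝ^p`. -/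
def postUn (α σ2 γ a c : ℝ) {n p : ℕ} (X : Matrix (Fin n) (Fin p) ℝ) (y : Fin n → ℝ) :
    Measure (Fin p → ℝ) :=
  Measure.sum fun S : Finset (Fin p) =>
    ENNReal.ofReal (priorS a c n p S) • postComp α σ2 γ X y S

/-- The empirical Bayes posterior `π^n` on `ℝ^p` (normalized). -/
def post (α σ2 γ a c : ℝ) {n p : ℕ} (X : Matrix (Fin n) (Fin p) ℝ) (y : Fin n → ℝ) :
    Measure (Fin p → ℝ) :=
  (postUn α σ2 γ a c X y Set.univ)⁻¹ • postUn α σ2 γ a c X y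

/-- One coordinate of a mean-field distribution: `φ N(μ, τ²) + (1-φ) δ₀`. -/
def mixComp (φ μ : ℝ) (τ2 : ℝ≥0) : Measure ℝ :=
  ENNReal.ofReal φ • gaussianReal μ τ2 + ENNReal.ofReal (1 - φ) • Measure.dirac 0

/-- A mean-field distribution on `ℝ^p`. -/
def meanField {p : ℕ} (φ μ : Fin p → ℝ) (τ2 : Fin p → ℝ≥0) : Measure (Fin p → ℝ) :=
  Measure.pi fun j => mixComp (φ j) (μ j) (τ2 j)

/-- The mean-field variational family `Q`. -/
def MeanFieldFamily (p : ℕ) : Set (Measure (Fin p → ℝ)) :=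
  { q | ∃ (φ μ : Fin p → ℝ) (τ2 : Fin p → ℝ≥0),
      (∀ j, φ j ∈ Set.Icc (0 : ℝ) 1) ∧ (∀ j, 0 < τ2 j) ∧ q = meanField φ μ τ2 }

/-- Kullback–Leibler divergence `K(q, P) = ∫ log (dq/dP) dq`, set to `⊤` when `q` is not
absolutely continuous with respect to `P`. -/
def KL {𝓧 : Type*} [MeasurableSpace 𝓧] (q P : Measure 𝓧) : EReal :=
  if q ≪ P then ((∫ x, Real.log (q.rnDeriv P x).toReal ∂q : ℝ) : EReal) else ⊤

/-- `q` is a variational approximation of `P`: it belongs to the mean-field family and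
minimizes the Kullback–Leibler divergence to `P` over that family. -/
def IsVarApprox {p : ℕ} (q P : Measure (Fin p → ℝ)) : Prop :=
  q ∈ MeanFieldFamily p ∧ ∀ q' ∈ MeanFieldFamily p, KL q P ≤ KL q' P

/-- The sampling distribution of the data: `y ~ N_n(Xβ, σ² I_n)`. -/
def dataDist (σ2 : ℝ) {n p : ℕ} (X : Matrix (Fin n) (Fin p) ℝ) (β : Fin p → ℝ) :
    Measure (Fin n → ℝ) :=
  Measure.pi fun i => gaussianReal (X.mulVec β i) σ2.toNNReal

end VB

namespace VB

theorem KL_bound {Ω : Type*} [MeasurableSpace Ω] (q P : Measure Ω) [IsProbabilityMeasure q]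
    [IsProbabilityMeasure P] (G : Ω → ℝ) (hG : Integrable G q)
    (h : q ≤ P.withDensity (fun x => ENNReal.ofReal (Real.exp (G x)))) :
    q ≪ P ∧ Integrable (fun x => Real.log (q.rnDeriv P x).toReal) q ∧
      ∫ x, Real.log (q.rnDeriv P x).toReal ∂q ≤ ∫ x, G x ∂q := by
  have hac : q ≪ P := h.absolutelyContinuous.trans (withDensity_absolutelyContinuous _ _)
  have hle : ∀ᵐ x ∂P, (q.rnDeriv P x).toReal ≤ Real.exp (G x) := by
    have : ∀ᵐ x ∂P, q.rnDeriv P x ≤ ENNReal.ofReal (Real.exp (G x)) := by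
      refine ae_le_of_forall_setLIntegral_le_of_sigmaFinite (Measure.measurable_rnDeriv q P) ?_
      intro s hs _
      rw [Measure.setLIntegral_rnDeriv hac]
      refine (h s).trans ?_
      rw [withDensity_apply _ hs]
    filter_upwards [this] with x hx
    exact ENNReal.toReal_le_of_le_ofReal (Real.exp_pos _).le hx
  have hfi : Integrable (fun x => (q.rnDeriv P x).toReal) P := Measure.integrable_toReal_rnDeriv
  have hfG : Integrable (fun x => (q.rnDeriv P x).toReal * G x) P := by
    have := (integrable_rnDeriv_smul_iff (f := G) hac).2 hG
    simpa using this
  have hint : Integrable (llr q P) q := by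
    rw [← integrable_rnDeriv_mul_log_iff hac]
    refine Integrable.mono' (((hfG.norm).add hfi).add (integrable_const (1 : ℝ))) ?_ ?_
    · exact ((Measure.measurable_rnDeriv q P).ennreal_toReal.mul
        (Measure.measurable_rnDeriv q P).ennreal_toReal.log).aestronglyMeasurable
    · filter_upwards [hle] with x hx
      set f := (q.rnDeriv P x).toReal with hf
      have hf0 : 0 ≤ f := ENNReal.toReal_nonneg
      simp only [Pi.add_apply, Real.norm_eq_abs]
      rcases hf0.eq_or_lt with h0 | h0
      · rw [← h0]; simp; positivity
      · have h1 : Real.log f ≤ G x := by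
          have := Real.log_le_log h0 hx
          rwa [Real.log_exp] at this
        have h2 : f * Real.log f ≤ f * G x := by gcongr
        have h3 : -(f * Real.log f) ≤ 1 := by
          have := Real.log_le_sub_one_of_pos (inv_pos.2 h0)
          rw [Real.log_inv] at this
          have h4 : f * (-Real.log f) ≤ f * (f⁻¹ - 1) := by gcongr
          rw [mul_sub, mul_inv_cancel₀ h0.ne'] at h4
          linarith
        rw [abs_le]
        have := le_abs_self (f * G x)
        have := abs_nonneg (f * G x)
        constructor <;> linarith
  refine ⟨hac, hint, ?_⟩
  refine integral_mono_ae hint hG ?_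
  filter_upwards [hac.ae_le hle, Measure.rnDeriv_pos hac, hac.ae_le (Measure.rnDeriv_lt_top q P)]
    with x hx h0 ht
  have := Real.log_le_log (ENNReal.toReal_pos h0.ne' ht.ne) hx
  rwa [Real.log_exp] at this

theorem DV {Ω : Type*} [MeasurableSpace Ω] (q P : Measure Ω) [IsProbabilityMeasure q]
    [IsProbabilityMeasure P] (hac : q ≪ P)
    (hint : Integrable (fun x => Real.log (q.rnDeriv P x).toReal) q)
    (A : Set Ω) (hA : MeasurableSet A) (κ : ℝ) :
    κ * (q A).toReal ≤ ∫ x, Real.log (q.rnDeriv P x).toReal ∂q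
      + (Real.exp κ - 1) * (P A).toReal := by
  have hfi : Integrable (fun x => (q.rnDeriv P x).toReal) P := Measure.integrable_toReal_rnDeriv
  have hfl := (integrable_rnDeriv_mul_log_iff hac).2 hint
  have e1 : ∫ x, Real.log (q.rnDeriv P x).toReal ∂q
      = ∫ x, (q.rnDeriv P x).toReal * Real.log (q.rnDeriv P x).toReal ∂P := by
    rw [← integral_rnDeriv_smul (f := fun x => Real.log (q.rnDeriv P x).toReal) hac]
    rfl
  have e2 : (q A).toReal = ∫ x, A.indicator (fun x => (q.rnDeriv P x).toReal) x ∂P := by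
    rw [integral_indicator hA, Measure.setIntegral_toReal_rnDeriv hac]; rfl
  have e3 : (P A).toReal = ∫ x, A.indicator (fun _ => (1 : ℝ)) x ∂P := by
    rw [integral_indicator hA]; simp; rfl
  have e4 : (1 : ℝ) = ∫ x, (q.rnDeriv P x).toReal ∂P := by
    rw [Measure.integral_toReal_rnDeriv hac]; simp
  have i2 : Integrable (A.indicator (fun x => (q.rnDeriv P x).toReal)) P := hfi.indicator hA
  have i3 : Integrable (A.indicator (fun _ => (1 : ℝ))) P := (integrable_const _).indicator hA
  have i4 : Integrable (fun x => 1 + (Real.exp κ - 1) * A.indicator (fun _ => (1 : ℝ)) x) P :=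
    (integrable_const _).add (i3.const_mul _)
  have key : ∫ x, (κ * A.indicator (fun x => (q.rnDeriv P x).toReal) x
        + (q.rnDeriv P x).toReal) ∂P ≤
      ∫ x, ((q.rnDeriv P x).toReal * Real.log (q.rnDeriv P x).toReal
        + (1 + (Real.exp κ - 1) * A.indicator (fun _ => (1 : ℝ)) x)) ∂P := by
    refine integral_mono ((i2.const_mul κ).add hfi) (hfl.add
      ((integrable_const _).add (i3.const_mul _))) ?_
    intro x
    have hf0 : 0 ≤ (q.rnDeriv P x).toReal := ENNReal.toReal_nonneg
    set f := (q.rnDeriv P x).toReal with hf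
    have main : ∀ t : ℝ, t * f + f ≤ f * Real.log f + Real.exp t := by
      intro t
      rcases hf0.eq_or_lt with h0 | h0
      · rw [← h0]; simp; exact (Real.exp_pos _).le
      · have h1 := Real.add_one_le_exp (t - Real.log f)
        rw [Real.exp_sub, Real.exp_log h0, le_div_iff₀ h0] at h1
        nlinarith
    by_cases hx : x ∈ A
    · simp only [Set.indicator_of_mem hx]
      have := main κ
      simp only [← hf]
      linarith
    · simp only [Set.indicator_of_notMem hx]
      have := main 0
      rw [Real.exp_zero] at this
      linarith
  rw [integral_add (i2.const_mul κ) hfi, integral_add hfl i4,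
    integral_add (integrable_const _) (i3.const_mul _), integral_const_mul, integral_const_mul,
    ← e1, ← e2, ← e3, ← e4] at key
  simp at key
  linarith

theorem measurable_embed {p : ℕ} (S : Finset (Fin p)) : Measurable (embed S) := by
  refine measurable_pi_lambda _ fun j => ?_
  by_cases h : j ∈ S
  · simp only [embed, h, dite_true]; exact measurable_pi_apply _
  · simp only [embed, h, dite_false]; exact measurable_const

theorem mem_config {p : ℕ} (β : Fin p → ℝ) (j : Fin p) : j ∈ config β ↔ β j ≠ 0 := by
  simp [config]

theorem config_embed_subset {p : ℕ} (S : Finset (Fin p)) (b : S → ℝ) :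
    config (embed S b) ⊆ S := by
  intro j hj
  rw [mem_config] at hj
  by_contra h
  exact hj (by simp [embed, h])

theorem config_embed_eq {p : ℕ} (S : Finset (Fin p)) (b : S → ℝ) (hb : ∀ j, b j ≠ 0) :
    config (embed S b) = S := by
  ext j
  rw [mem_config]
  by_cases h : j ∈ S
  · simp [embed, h, hb]
  · simp [embed, h]

theorem measurableSet_config_card {p : ℕ} (m : ℝ) :
    MeasurableSet {b : Fin p → ℝ | m < ((config b).card : ℝ)} := by
  have : Measurable fun b : Fin p → ℝ => ((config b).card : ℝ) := by
    have e : (fun b : Fin p → ℝ => ((config b).card : ℝ))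
        = fun b => ∑ j, if b j ≠ 0 then (1 : ℝ) else 0 := by
      ext b
      rw [Finset.sum_ite]
      simp [config]
    rw [e]
    refine Finset.measurable_sum _ fun j _ => ?_
    refine Measurable.ite ?_ measurable_const measurable_const
    exact (measurableSet_singleton (0 : ℝ)).compl.preimage (measurable_pi_apply j)
  exact measurableSet_lt measurable_const this

instance (φ μ : ℝ) (τ2 : ℝ≥0) : IsFiniteMeasure (mixComp φ μ τ2) := by
  constructor
  simp [mixComp]

/-- Mixture weight of a configuration. -/
def mfW {p : ℕ} (φ : Fin p → ℝ) (T : Finset (Fin p)) : ℝ≥0∞ :=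
  (∏ j ∈ T, ENNReal.ofReal (φ j)) * ∏ j ∈ Finset.univ \ T, ENNReal.ofReal (1 - φ j)

/-- Gaussian component of a mean-field distribution. -/
def mfG {p : ℕ} (μ : Fin p → ℝ) (τ2 : Fin p → ℝ≥0) (T : Finset (Fin p)) : Measure (T → ℝ) :=
  Measure.pi fun j : T => gaussianReal (μ j) (τ2 j)

instance {p : ℕ} (μ : Fin p → ℝ) (τ2 : Fin p → ℝ≥0) (T : Finset (Fin p)) :
    IsProbabilityMeasure (mfG μ τ2 T) := by unfold mfG; infer_instance

theorem meanField_eq_sum {p : ℕ} (φ μ : Fin p → ℝ) (τ2 : Fin p → ℝ≥0) :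
    meanField φ μ τ2 = Measure.sum fun T : Finset (Fin p) =>
      mfW φ T • (mfG μ τ2 T).map (embed T) := by
  unfold meanField
  refine Measure.pi_eq fun s hs => ?_
  rw [Measure.sum_apply _ (MeasurableSet.univ_pi hs), tsum_fintype]
  simp only [mixComp, Measure.add_apply, Measure.smul_apply, smul_eq_mul]
  rw [Finset.prod_add, Finset.powerset_univ]
  refine Finset.sum_congr rfl fun T _ => ?_
  rw [Measure.map_apply (measurable_embed T) (MeasurableSet.univ_pi hs)]
  by_cases h0 : ∀ j, j ∉ T → (0 : ℝ) ∈ s j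
  · have e : embed T ⁻¹' Set.univ.pi s = Set.univ.pi fun j : T => s j := by
      ext b
      simp only [Set.mem_preimage, Set.mem_univ_pi]
      constructor
      · intro h j
        have := h j
        simpa [embed] using this
      · intro h j
        by_cases hj : j ∈ T
        · simpa [embed, hj] using h ⟨j, hj⟩
        · simpa [embed, hj] using h0 j hj
    rw [e, mfG, Measure.pi_pi, mfW, Finset.prod_mul_distrib]
    have e2 : ∏ j ∈ Finset.univ \ T, (ENNReal.ofReal (1 - φ j) * (Measure.dirac 0) (s j))
        = ∏ j ∈ Finset.univ \ T, ENNReal.ofReal (1 - φ j) := by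
      refine Finset.prod_congr rfl fun j hj => ?_
      rw [Measure.dirac_apply' _ (hs j)]
      simp only [Finset.mem_sdiff] at hj
      simp [h0 j hj.2]
    rw [e2, ← Finset.prod_coe_sort T (fun j => gaussianReal (μ j) (τ2 j) (s j))]
    ring
  · push Not at h0
    obtain ⟨j, hj, hj0⟩ := h0
    have e : embed T ⁻¹' Set.univ.pi s = ∅ := by
      ext b
      simp only [Set.mem_preimage, Set.mem_univ_pi, Set.mem_empty_iff_false, iff_false]
      intro h
      have := h j
      simp [embed, hj] at this
      exact hj0 this
    rw [e, measure_empty, mul_zero]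
    symm
    have : ∏ j ∈ Finset.univ \ T, (ENNReal.ofReal (1 - φ j) * (Measure.dirac 0) (s j)) = 0 := by
      refine Finset.prod_eq_zero (i := j) (by simp [hj]) ?_
      rw [Measure.dirac_apply' _ (hs j)]
      simp [hj0]
    rw [this, mul_zero]

theorem isProb_meanField {p : ℕ} (φ μ : Fin p → ℝ) (τ2 : Fin p → ℝ≥0)
    (hφ : ∀ j, φ j ∈ Set.Icc (0 : ℝ) 1) : IsProbabilityMeasure (meanField φ μ τ2) := by
  have : ∀ j, IsProbabilityMeasure (mixComp (φ j) (μ j) (τ2 j)) := by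
    intro j
    constructor
    simp only [mixComp, Measure.add_apply, Measure.smul_apply, smul_eq_mul, measure_univ, mul_one]
    rw [← ENNReal.ofReal_add (hφ j).1 (by linarith [(hφ j).2])]
    simp
  unfold meanField
  infer_instance

theorem pi_le {ι : Type*} [Fintype ι] (μ ν : ι → Measure ℝ) [∀ i, SigmaFinite (μ i)]
    (h : ∀ i, μ i ≤ ν i) : Measure.pi μ ≤ Measure.pi ν := by
  have h1 : (Measure.pi μ).toOuterMeasure ≤
      OuterMeasure.pi (fun i => (ν i).toOuterMeasure) := by
    rw [OuterMeasure.le_pi]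
    intro s _
    change Measure.pi μ (Set.univ.pi s) ≤ _
    rw [Measure.pi_pi]
    exact Finset.prod_le_prod' fun i _ => h i (s i)
  rw [Measure.le_iff]
  intro s hs
  refine (h1 s).trans ?_
  rw [Measure.pi, toMeasure_apply _ _ hs]

theorem pi_smul {ι : Type*} [Fintype ι] (c : ι → ℝ≥0) (ν : ι → Measure ℝ)
    [∀ i, SigmaFinite (ν i)] :
    Measure.pi (fun i => c i • ν i) = (∏ i, c i) • Measure.pi ν := by
  refine Measure.pi_eq fun s _ => ?_
  simp only [Measure.smul_apply, Measure.pi_pi, ENNReal.smul_def, smul_eq_mul]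
  rw [Finset.prod_mul_distrib]
  simp

theorem gaussianReal_le (m : ℝ) (v : ℝ≥0) (hv : v ≠ 0) :
    gaussianReal m v ≤ (Real.toNNReal (Real.sqrt (2 * π * v))⁻¹) • (volume : Measure ℝ) := by
  rw [gaussianReal_of_var_ne_zero _ hv]
  have : (volume : Measure ℝ).withDensity (gaussianPDF m v) ≤
      volume.withDensity (fun _ => ENNReal.ofReal (Real.sqrt (2 * π * v))⁻¹) := by
    refine withDensity_mono (Eventually.of_forall fun x => ?_)
    rw [gaussianPDF]
    refine ENNReal.ofReal_le_ofReal ?_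
    rw [gaussianPDFReal]
    refine mul_le_of_le_one_right (by positivity) ?_
    rw [Real.exp_le_one_iff]
    have : 0 ≤ (x - m) ^ 2 / (2 * v) := by positivity
    rw [neg_div]; linarith
  refine this.trans_eq ?_
  rw [withDensity_const]
  rfl

theorem mfG_le {p : ℕ} (μ : Fin p → ℝ) (τ2 : Fin p → ℝ≥0) (hτ : ∀ j, 0 < τ2 j)
    (T : Finset (Fin p)) :
    mfG μ τ2 T ≤ ENNReal.ofReal (∏ j : T, (Real.sqrt (2 * π * τ2 j))⁻¹) • volume := by
  have := pi_le (fun j : T => gaussianReal (μ j) (τ2 j))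
    (fun j : T => (Real.toNNReal (Real.sqrt (2 * π * τ2 j))⁻¹) • (volume : Measure ℝ))
    (fun j => gaussianReal_le _ _ (hτ j).ne')
  refine this.trans_eq ?_
  rw [pi_smul, ← volume_pi, ← Real.toNNReal_prod_of_nonneg]
  · rfl
  · intro i _; positivity

theorem sqNorm_eq_dot {ι : Type*} [Fintype ι] (v : ι → ℝ) : sqNorm v = v ⬝ᵥ v := by
  simp [sqNorm, dotProduct, sq]

theorem sqNorm_nonneg {ι : Type*} [Fintype ι] (v : ι → ℝ) : 0 ≤ sqNorm v :=
  Finset.sum_nonneg fun _ _ => sq_nonneg _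

theorem measurable_sqNorm {ι : Type*} [Fintype ι] : Measurable (sqNorm : (ι → ℝ) → ℝ) := by
  unfold sqNorm
  exact Finset.measurable_sum _ fun i _ => (measurable_pi_apply i).pow_const 2

theorem measurable_mulVec {ι κ : Type*} [Fintype ι] [Fintype κ] (A : Matrix ι κ ℝ) :
    Measurable (fun v : κ → ℝ => A *ᵥ v) := by
  refine measurable_pi_lambda _ fun i => ?_
  simp only [Matrix.mulVec, dotProduct]
  exact Finset.measurable_sum _ fun j _ => (measurable_pi_apply j).const_mul _

theorem quad_eq {n p : ℕ} (X : Matrix (Fin n) (Fin p) ℝ) (S : Finset (Fin p)) (v : S → ℝ) :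
    v ⬝ᵥ (gram X S).mulVec v = sqNorm ((XS X S).mulVec v) := by
  rw [sqNorm_eq_dot, gram, ← Matrix.mulVec_mulVec, Matrix.dotProduct_mulVec,
    Matrix.vecMul_transpose]

theorem normal_eq {n p : ℕ} (X : Matrix (Fin n) (Fin p) ℝ) (S : Finset (Fin p))
    (hdet : IsUnit (gram X S).det) (y : Fin n → ℝ) (v : S → ℝ) :
    (XS X S).mulVec v ⬝ᵥ (y - (XS X S).mulVec (lse X S y)) = 0 := by
  rw [dotProduct_comm, Matrix.dotProduct_mulVec, ← Matrix.mulVec_transpose, Matrix.mulVec_sub,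
    Matrix.mulVec_mulVec, ← gram, lse, Matrix.mulVec_mulVec, Matrix.mul_nonsing_inv _ hdet,
    Matrix.one_mulVec, sub_self, zero_dotProduct]

theorem pythag {n p : ℕ} (X : Matrix (Fin n) (Fin p) ℝ) (S : Finset (Fin p))
    (hdet : IsUnit (gram X S).det) (y : Fin n → ℝ) (b : S → ℝ) :
    sqNorm (y - (XS X S).mulVec b) = sqNorm (y - (XS X S).mulVec (lse X S y))
      + sqNorm ((XS X S).mulVec (b - lse X S y)) := by
  have h := normal_eq X S hdet y (b - lse X S y)
  have e : y - (XS X S).mulVec b = (y - (XS X S).mulVec (lse X S y))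
      - (XS X S).mulVec (b - lse X S y) := by
    rw [Matrix.mulVec_sub]; abel
  rw [e]
  generalize y - (XS X S).mulVec (lse X S y) = r at *
  generalize (XS X S).mulVec (b - lse X S y) = w at *
  have h' : r ⬝ᵥ w = 0 := by rw [dotProduct_comm, h]
  rw [sqNorm_eq_dot, sqNorm_eq_dot, sqNorm_eq_dot, sub_dotProduct, dotProduct_sub,
    dotProduct_sub, h, h']
  ring

theorem sqNorm_XS_le {n p : ℕ} (X : Matrix (Fin n) (Fin p) ℝ)
    (hstd : ∀ j, ∑ i, X i j ^ 2 = (n : ℝ)) (S : Finset (Fin p)) (v : S → ℝ) :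
    sqNorm ((XS X S).mulVec v) ≤ (S.card * n : ℝ) * sqNorm v := by
  have h1 : ∀ i, ((XS X S).mulVec v i) ^ 2 ≤ (∑ j : S, X i j ^ 2) * sqNorm v := by
    intro i
    exact Finset.sum_mul_sq_le_sq_mul_sq Finset.univ (fun j : S => X i j) v
  calc sqNorm ((XS X S).mulVec v) ≤ ∑ i, (∑ j : S, X i j ^ 2) * sqNorm v :=
        Finset.sum_le_sum fun i _ => h1 i
    _ = (∑ i, ∑ j : S, X i j ^ 2) * sqNorm v := by rw [Finset.sum_mul]
    _ = (S.card * n : ℝ) * sqNorm v := by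
        rw [Finset.sum_comm]; simp [hstd]

theorem gram_psd {n p : ℕ} (X : Matrix (Fin n) (Fin p) ℝ) (S : Finset (Fin p)) :
    (gram X S).PosSemidef := by
  have := Matrix.posSemidef_conjTranspose_mul_self (XS X S)
  rwa [Matrix.conjTranspose_eq_transpose_of_trivial] at this

theorem det_gram_pos {n p : ℕ} (X : Matrix (Fin n) (Fin p) ℝ) (S : Finset (Fin p))
    (hdet : IsUnit (gram X S).det) : 0 < (gram X S).det :=
  lt_of_le_of_ne (gram_psd X S).det_nonneg hdet.ne_zero.symm

theorem det_gram_ge {n p : ℕ} (X : Matrix (Fin n) (Fin p) ℝ) (S : Finset (Fin p)) (l : ℝ)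
    (hl : 0 ≤ l) (h : ∀ v : S → ℝ, l * sqNorm v ≤ v ⬝ᵥ (gram X S).mulVec v) :
    l ^ S.card ≤ (gram X S).det := by
  have hH := (gram_psd X S).isHermitian
  rw [hH.det_eq_prod_eigenvalues]
  have : l ^ S.card = ∏ _i : S, l := by simp
  rw [this]
  refine Finset.prod_le_prod (fun _ _ => hl) fun i _ => ?_
  have h1 := hH.eigenvalues_eq i
  have h2 := h (hH.eigenvectorBasis i).ofLp
  have h3 : sqNorm (hH.eigenvectorBasis i).ofLp = 1 := by
    have := (hH.eigenvectorBasis).orthonormal.1 i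
    rw [EuclideanSpace.norm_eq, Real.sqrt_eq_one] at this
    simpa [sqNorm] using this
  rw [h3, mul_one] at h2
  simp only [star_trivial] at h1
  change l ≤ hH.eigenvalues i
  rw [h1]
  exact h2

theorem lintegral_gauss_std {ι : Type*} [Fintype ι] (t : ℝ) (ht : 0 < t) :
    ∫⁻ b : ι → ℝ, ENNReal.ofReal (Real.exp (-t * sqNorm b))
      = ENNReal.ofReal ((Real.sqrt (π / t)) ^ Fintype.card ι) := by
  have e : ∀ b : ι → ℝ, Real.exp (-t * sqNorm b) = ∏ i, Real.exp (-t * b i ^ 2) := by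
    intro b
    rw [← Real.exp_sum, sqNorm, Finset.mul_sum]
  simp_rw [e]
  rw [← ofReal_integral_eq_lintegral_ofReal]
  · rw [integral_fintype_prod_volume_eq_pow (fun x : ℝ => Real.exp (-t * x ^ 2)), integral_gaussian]
  · exact Integrable.fintype_prod (f := fun _ x => Real.exp (-t * x ^ 2))
      (fun _ => integrable_exp_neg_mul_sq ht)
  · exact Eventually.of_forall fun b => Finset.prod_nonneg fun i _ => (Real.exp_pos _).le

theorem lintegral_gauss {n p : ℕ} (X : Matrix (Fin n) (Fin p) ℝ) (S : Finset (Fin p))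
    (hdet : IsUnit (gram X S).det) (m : S → ℝ) (t : ℝ) (ht : 0 < t) :
    ∫⁻ b : S → ℝ, ENNReal.ofReal (Real.exp (-t * sqNorm ((XS X S).mulVec (b - m))))
      = ENNReal.ofReal ((Real.sqrt (π / t)) ^ S.card * (Real.sqrt (gram X S).det)⁻¹) := by
  rw [lintegral_sub_right_eq_self
    (fun b : S → ℝ => ENNReal.ofReal (Real.exp (-t * sqNorm ((XS X S).mulVec b)))) m]
  obtain ⟨B, hB⟩ : ∃ B : Matrix S S ℝ, gram X S = Bᵀ * B := by
    open scoped MatrixOrder in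
    obtain ⟨B, hB⟩ := CStarAlgebra.nonneg_iff_eq_star_mul_self.mp (gram_psd X S).nonneg
    exact ⟨B, hB⟩
  have hd : (gram X S).det = B.det ^ 2 := by
    rw [hB, Matrix.det_mul, Matrix.det_transpose, sq]
  have hB0 : B.det ≠ 0 := by
    intro h
    rw [h] at hd
    exact (det_gram_pos X S hdet).ne' (by rw [hd]; ring)
  have e : ∀ b : S → ℝ, sqNorm ((XS X S).mulVec b) = sqNorm (Matrix.toLin' B b) := by
    intro b
    rw [← quad_eq, hB, Matrix.toLin'_apply, sqNorm_eq_dot, ← Matrix.mulVec_mulVec,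
      Matrix.dotProduct_mulVec, Matrix.vecMul_transpose]
  simp_rw [e]
  have hm : Measurable (Matrix.toLin' B) := by
    have := measurable_mulVec B
    exact this
  have hF : Measurable fun v : S → ℝ => ENNReal.ofReal (Real.exp (-t * sqNorm v)) :=
    ((measurable_sqNorm.const_mul _).exp).ennreal_ofReal
  rw [← lintegral_map hF hm, Real.map_matrix_volume_pi_eq_smul_volume_pi hB0,
    lintegral_smul_measure, lintegral_gauss_std t ht, smul_eq_mul, hd, Real.sqrt_sq_eq_abs, abs_inv,
    ← ENNReal.ofReal_mul (by positivity), mul_comm]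
  simp

/-- Residual sum of squares. -/
def rss {n p : ℕ} (X : Matrix (Fin n) (Fin p) ℝ) (S : Finset (Fin p)) (y : Fin n → ℝ) : ℝ :=
  sqNorm (y - (XS X S).mulVec (lse X S y))

/-- Total mass of a posterior component. -/
def mass (α σ2 γ : ℝ) {n p : ℕ} (X : Matrix (Fin n) (Fin p) ℝ) (S : Finset (Fin p))
    (y : Fin n → ℝ) : ℝ :=
  (Real.sqrt (γ / (α + γ))) ^ S.card * Real.exp (-(α / (2 * σ2)) * rss X S y)

/-- Normalizing constant of the posterior. -/
def Zr (α σ2 γ a c : ℝ) {n p : ℕ} (X : Matrix (Fin n) (Fin p) ℝ) (y : Fin n → ℝ) : ℝ :=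
  ∑ S : Finset (Fin p), priorS a c n p S * mass α σ2 γ X S y

/-- Normalizing factor of the prior density. -/
def nrm (σ2 γ : ℝ) {n p : ℕ} (X : Matrix (Fin n) (Fin p) ℝ) (S : Finset (Fin p)) : ℝ :=
  Real.sqrt ((gram X S).det * (γ / (2 * π * σ2)) ^ S.card)

theorem dens_eq (α σ2 γ : ℝ) {n p : ℕ} (X : Matrix (Fin n) (Fin p) ℝ) (S : Finset (Fin p))
    (hdet : IsUnit (gram X S).det) (y : Fin n → ℝ) (b : S → ℝ) :
    likeα α σ2 X S y b * priorDens σ2 γ X S y b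
      = (nrm σ2 γ X S * Real.exp (-(α / (2 * σ2)) * rss X S y)) *
        Real.exp (-((α + γ) / (2 * σ2)) * sqNorm ((XS X S).mulVec (b - lse X S y))) := by
  rw [likeα, priorDens, quad_eq, pythag X S hdet, ← nrm, ← rss]
  rw [mul_add, Real.exp_add]
  have : -((α + γ) / (2 * σ2)) * sqNorm ((XS X S).mulVec (b - lse X S y))
    = -(α / (2 * σ2)) * sqNorm ((XS X S).mulVec (b - lse X S y))
      + -(γ / (2 * σ2)) * sqNorm ((XS X S).mulVec (b - lse X S y)) := by ring
  rw [this, Real.exp_add]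
  ring

theorem nrm_pos (σ2 γ : ℝ) (hσ2 : 0 < σ2) (hγ : 0 < γ) {n p : ℕ} (X : Matrix (Fin n) (Fin p) ℝ)
    (S : Finset (Fin p)) (hdet : IsUnit (gram X S).det) : 0 < nrm σ2 γ X S := by
  have := det_gram_pos X S hdet
  unfold nrm
  positivity

theorem sqrt_pow_nat (x : ℝ) (hx : 0 ≤ x) (k : ℕ) : Real.sqrt (x ^ k) = Real.sqrt x ^ k := by
  have h : x ^ k = (Real.sqrt x ^ k) ^ 2 := by
    rw [← pow_mul, mul_comm, pow_mul, Real.sq_sqrt hx]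
  rw [h, Real.sqrt_sq (by positivity)]

theorem postComp_univ (α σ2 γ : ℝ) (hσ2 : 0 < σ2) (hα : 0 < α) (hγ : 0 < γ) {n p : ℕ}
    (X : Matrix (Fin n) (Fin p) ℝ) (S : Finset (Fin p))
    (hdet : IsUnit (gram X S).det) (y : Fin n → ℝ) :
    postComp α σ2 γ X y S Set.univ = ENNReal.ofReal (mass α σ2 γ X S y) := by
  rw [postComp, Measure.map_apply (measurable_embed S) MeasurableSet.univ, Set.preimage_univ,
    withDensity_apply _ MeasurableSet.univ, Measure.restrict_univ]
  simp_rw [dens_eq α σ2 γ X S hdet y]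
  have hn := nrm_pos σ2 γ hσ2 hγ X S hdet
  have hd := det_gram_pos X S hdet
  have h0 : 0 ≤ nrm σ2 γ X S * Real.exp (-(α / (2 * σ2)) * rss X S y) := by positivity
  simp_rw [ENNReal.ofReal_mul h0]
  rw [lintegral_const_mul' _ _ ENNReal.ofReal_ne_top,
    lintegral_gauss X S hdet _ _ (by positivity), ← ENNReal.ofReal_mul h0]
  congr 1
  rw [mass, nrm, Real.sqrt_mul hd.le, sqrt_pow_nat _ (by positivity)]
  have hs : Real.sqrt (gram X S).det ≠ 0 := (Real.sqrt_pos.2 hd).ne'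
  have : Real.sqrt (γ / (α + γ)) = Real.sqrt (γ / (2 * π * σ2)) *
      Real.sqrt (π / ((α + γ) / (2 * σ2))) := by
    rw [← Real.sqrt_mul (by positivity)]
    congr 1
    field_simp
  rw [this, mul_pow]
  field_simp

theorem wt_nonneg (a c : ℝ) (hc : 0 < c) (n p : ℕ) (S : Finset (Fin p)) :
    0 ≤ priorSWt a c n p S := by
  unfold priorSWt
  split_ifs
  · positivity
  · exact le_rfl

theorem wt_pos (a c : ℝ) (hc : 0 < c) (n p : ℕ) (hp : 0 < p) (S : Finset (Fin p))
    (h : S.card ≤ n) : 0 < priorSWt a c n p S := by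
  unfold priorSWt
  rw [if_pos h]
  have : 0 < p.choose S.card := Nat.choose_pos (by simpa using Finset.card_le_univ S)
  positivity

theorem wt_sum_pos (a c : ℝ) (hc : 0 < c) (n p : ℕ) (hp : 0 < p) :
    0 < ∑ T : Finset (Fin p), priorSWt a c n p T :=
  Finset.sum_pos' (fun T _ => wt_nonneg a c hc n p T)
    ⟨∅, Finset.mem_univ _, wt_pos a c hc n p hp ∅ (by simp)⟩

theorem priorS_nonneg (a c : ℝ) (hc : 0 < c) (n p : ℕ) (S : Finset (Fin p)) :
    0 ≤ priorS a c n p S :=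
  div_nonneg (wt_nonneg a c hc n p S) (Finset.sum_nonneg fun T _ => wt_nonneg a c hc n p T)

theorem priorS_pos (a c : ℝ) (hc : 0 < c) (n p : ℕ) (hp : 0 < p) (S : Finset (Fin p))
    (h : S.card ≤ n) : 0 < priorS a c n p S :=
  div_pos (wt_pos a c hc n p hp S h) (wt_sum_pos a c hc n p hp)

theorem priorS_zero (a c : ℝ) (n p : ℕ) (S : Finset (Fin p))
    (h : ¬ S.card ≤ n) : priorS a c n p S = 0 := by
  simp [priorS, priorSWt, h]

theorem mass_pos (α σ2 γ : ℝ) (hα : 0 < α) (hγ : 0 < γ) {n p : ℕ}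
    (X : Matrix (Fin n) (Fin p) ℝ) (S : Finset (Fin p)) (y : Fin n → ℝ) :
    0 < mass α σ2 γ X S y := by
  unfold mass; positivity

theorem comp_univ (α σ2 γ a c : ℝ) (hσ2 : 0 < σ2) (hα : 0 < α) (hγ : 0 < γ) (hc : 0 < c)
    {n p : ℕ} (X : Matrix (Fin n) (Fin p) ℝ)
    (hns : ∀ S : Finset (Fin p), S.card ≤ n → IsUnit (gram X S).det) (y : Fin n → ℝ)
    (S : Finset (Fin p)) :
    (ENNReal.ofReal (priorS a c n p S) • postComp α σ2 γ X y S) Set.univ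
      = ENNReal.ofReal (priorS a c n p S * mass α σ2 γ X S y) := by
  rw [Measure.smul_apply, smul_eq_mul]
  by_cases h : S.card ≤ n
  · rw [postComp_univ α σ2 γ hσ2 hα hγ X S (hns S h), ENNReal.ofReal_mul (priorS_nonneg a c hc n p S)]
  · simp [priorS_zero a c n p S h]

theorem postUn_univ (α σ2 γ a c : ℝ) (hσ2 : 0 < σ2) (hα : 0 < α) (hγ : 0 < γ) (hc : 0 < c)
    {n p : ℕ} (X : Matrix (Fin n) (Fin p) ℝ)
    (hns : ∀ S : Finset (Fin p), S.card ≤ n → IsUnit (gram X S).det) (y : Fin n → ℝ) :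
    postUn α σ2 γ a c X y Set.univ = ENNReal.ofReal (Zr α σ2 γ a c X y) := by
  rw [postUn, Measure.sum_apply _ MeasurableSet.univ, tsum_fintype, Zr, ENNReal.ofReal_sum_of_nonneg]
  · exact Finset.sum_congr rfl fun S _ => comp_univ α σ2 γ a c hσ2 hα hγ hc X hns y S
  · exact fun S _ => mul_nonneg (priorS_nonneg a c hc n p S) (mass_pos α σ2 γ hα hγ X S y).le

theorem Zr_pos (α σ2 γ a c : ℝ) (hα : 0 < α) (hγ : 0 < γ) (hc : 0 < c)
    {n p : ℕ} (hp : 0 < p) (X : Matrix (Fin n) (Fin p) ℝ) (y : Fin n → ℝ) :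
    0 < Zr α σ2 γ a c X y :=
  Finset.sum_pos' (fun S _ => mul_nonneg (priorS_nonneg a c hc n p S)
      (mass_pos α σ2 γ hα hγ X S y).le)
    ⟨∅, Finset.mem_univ _, mul_pos (priorS_pos a c hc n p hp ∅ (by simp))
      (mass_pos α σ2 γ hα hγ X ∅ y)⟩

theorem isProb_post (α σ2 γ a c : ℝ) (hσ2 : 0 < σ2) (hα : 0 < α) (hγ : 0 < γ) (hc : 0 < c)
    {n p : ℕ} (hp : 0 < p) (X : Matrix (Fin n) (Fin p) ℝ)
    (hns : ∀ S : Finset (Fin p), S.card ≤ n → IsUnit (gram X S).det) (y : Fin n → ℝ) :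
    IsProbabilityMeasure (post α σ2 γ a c X y) := by
  constructor
  rw [post, Measure.smul_apply, smul_eq_mul]
  refine ENNReal.inv_mul_cancel ?_ ?_
  · rw [postUn_univ α σ2 γ a c hσ2 hα hγ hc X hns y]
    simpa using Zr_pos α σ2 γ a c hα hγ hc hp X y
  · rw [postUn_univ α σ2 γ a c hσ2 hα hγ hc X hns y]
    simp

theorem post_tail (α σ2 γ a c : ℝ) (hσ2 : 0 < σ2) (hα : 0 < α) (hγ : 0 < γ) (hc : 0 < c)
    {n p : ℕ} (hp : 0 < p) (X : Matrix (Fin n) (Fin p) ℝ)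
    (hns : ∀ S : Finset (Fin p), S.card ≤ n → IsUnit (gram X S).det) (y : Fin n → ℝ) (m : ℝ) :
    post α σ2 γ a c X y {b | m < ((config b).card : ℝ)} ≤
      ENNReal.ofReal ((Zr α σ2 γ a c X y)⁻¹ *
        ∑ S : Finset (Fin p), if m < (S.card : ℝ) then
          priorS a c n p S * mass α σ2 γ X S y else 0) := by
  have hZ := Zr_pos α σ2 γ a c hα hγ hc hp X y
  rw [post, Measure.smul_apply, smul_eq_mul, postUn_univ α σ2 γ a c hσ2 hα hγ hc X hns y,
    ENNReal.ofReal_mul (by positivity), ENNReal.ofReal_inv_of_pos hZ]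
  gcongr
  have hnn : ∀ S : Finset (Fin p), 0 ≤ priorS a c n p S * mass α σ2 γ X S y := fun S =>
    mul_nonneg (priorS_nonneg a c hc n p S) (mass_pos α σ2 γ hα hγ X S y).le
  rw [postUn, Measure.sum_apply _ (measurableSet_config_card m), tsum_fintype,
    ENNReal.ofReal_sum_of_nonneg]
  · refine Finset.sum_le_sum fun S _ => ?_
    split_ifs with h
    · rw [← comp_univ α σ2 γ a c hσ2 hα hγ hc X hns y S]
      exact measure_mono (Set.subset_univ _)
    · rw [Measure.smul_apply, postComp, Measure.map_apply (measurable_embed S)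
        (measurableSet_config_card m)]
      have : embed S ⁻¹' {b | m < ((config b).card : ℝ)} = ∅ := by
        ext b
        simp only [Set.mem_preimage, Set.mem_ofPred_eq, Set.mem_empty_iff_false, iff_false]
        intro h2
        refine h (h2.trans_le ?_)
        exact_mod_cast Finset.card_le_card (config_embed_subset S b)
      rw [this]; simp
  · intro S _
    split_ifs
    · exact hnn S
    · exact le_rfl

/-- Constant part of the log density ratio bound. -/
def cst (α σ2 γ a c : ℝ) {n p : ℕ} (X : Matrix (Fin n) (Fin p) ℝ) (y : Fin n → ℝ)
    (τ2 : Fin p → ℝ≥0) (T : Finset (Fin p)) : ℝ :=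
  Real.log (Zr α σ2 γ a c X y) - Real.log (priorS a c n p T)
    + Real.log (∏ j : T, (Real.sqrt (2 * π * τ2 j))⁻¹)
    - Real.log (nrm σ2 γ X T) + (α / (2 * σ2)) * rss X T y

/-- Log density ratio bound. -/
def GT (α σ2 γ a c : ℝ) {n p : ℕ} (X : Matrix (Fin n) (Fin p) ℝ) (y : Fin n → ℝ)
    (τ2 : Fin p → ℝ≥0) (T : Finset (Fin p)) (x : Fin p → ℝ) : ℝ :=
  cst α σ2 γ a c X y τ2 T +
    ((α + γ) / (2 * σ2)) * (T.card * n + 1) * ∑ j : T, (x j - lse X T y j) ^ 2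

theorem measurable_GT (α σ2 γ a c : ℝ) {n p : ℕ} (X : Matrix (Fin n) (Fin p) ℝ) (y : Fin n → ℝ)
    (τ2 : Fin p → ℝ≥0) (T : Finset (Fin p)) : Measurable (GT α σ2 γ a c X y τ2 T) := by
  unfold GT
  refine measurable_const.add (Measurable.const_mul ?_ _)
  refine Finset.measurable_sum _ fun j _ => ?_
  exact ((measurable_pi_apply _).sub_const _).pow_const 2

theorem comp_le (α σ2 γ a c : ℝ) (hσ2 : 0 < σ2) (hα : 0 < α) (hγ : 0 < γ) (hc : 0 < c)
    {n p : ℕ} (hp : 0 < p) (X : Matrix (Fin n) (Fin p) ℝ)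
    (hstd : ∀ j, ∑ i, X i j ^ 2 = (n : ℝ))
    (hns : ∀ S : Finset (Fin p), S.card ≤ n → IsUnit (gram X S).det) (y : Fin n → ℝ)
    (μ : Fin p → ℝ) (τ2 : Fin p → ℝ≥0) (hτ : ∀ j, 0 < τ2 j) (T : Finset (Fin p))
    (hT : T.card ≤ n) :
    (mfG μ τ2 T).map (embed T) ≤ (post α σ2 γ a c X y).withDensity
      (fun x => ENNReal.ofReal (Real.exp (GT α σ2 γ a c X y τ2 T x))) := by
  have hZ := Zr_pos α σ2 γ a c hα hγ hc hp X y
  have hpr := priorS_pos a c hc n p hp T hT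
  have hn := nrm_pos σ2 γ hσ2 hγ X T (hns T hT)
  set K : ℝ := ∏ j : T, (Real.sqrt (2 * π * τ2 j))⁻¹ with hK
  have hKpos : 0 < K := Finset.prod_pos fun j _ => by
    have := hτ j
    positivity
  rw [Measure.le_iff]
  intro s hs
  have hs' := measurable_embed T hs
  have hGm : Measurable (fun x => ENNReal.ofReal (Real.exp (GT α σ2 γ a c X y τ2 T x))) :=
    (measurable_GT α σ2 γ a c X y τ2 T).exp.ennreal_ofReal
  have hLm : Measurable (fun b : T → ℝ =>
      ENNReal.ofReal (likeα α σ2 X T y b * priorDens σ2 γ X T y b)) := by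
    simp_rw [dens_eq α σ2 γ X T (hns T hT) y]
    refine Measurable.ennreal_ofReal (Measurable.const_mul (Measurable.exp
      (Measurable.const_mul ?_ _)) _)
    exact measurable_sqNorm.comp ((measurable_mulVec _).comp (measurable_id.sub_const _))
  have hGe : Measurable (fun b : T → ℝ =>
      ENNReal.ofReal (Real.exp (GT α σ2 γ a c X y τ2 T (embed T b)))) :=
    hGm.comp (measurable_embed T)
  rw [Measure.map_apply (measurable_embed T) hs, withDensity_apply _ hs]
  refine (mfG_le μ τ2 hτ T _).trans ?_
  rw [Measure.smul_apply, smul_eq_mul, post, Measure.restrict_smul, lintegral_smul_measure,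
    postUn_univ α σ2 γ a c hσ2 hα hγ hc X hns y, smul_eq_mul]
  have h1 : ENNReal.ofReal (priorS a c n p T) • postComp α σ2 γ X y T ≤ postUn α σ2 γ a c X y :=
    Measure.le_sum (fun S : Finset (Fin p) =>
      ENNReal.ofReal (priorS a c n p S) • postComp α σ2 γ X y S) T
  have h2 : ∫⁻ x in s, ENNReal.ofReal (Real.exp (GT α σ2 γ a c X y τ2 T x))
        ∂(ENNReal.ofReal (priorS a c n p T) • postComp α σ2 γ X y T) ≤
      ∫⁻ x in s, ENNReal.ofReal (Real.exp (GT α σ2 γ a c X y τ2 T x)) ∂(postUn α σ2 γ a c X y) :=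
    lintegral_mono' (Measure.restrict_mono le_rfl h1) le_rfl
  refine le_trans ?_ (mul_le_mul_right h2 _)
  rw [Measure.restrict_smul, lintegral_smul_measure, postComp,
    setLIntegral_map hs hGm (measurable_embed T),
    setLIntegral_withDensity_eq_setLIntegral_mul _ hLm hGe hs',
    smul_eq_mul, ← lintegral_const_mul' _ _ ENNReal.ofReal_ne_top,
    ← lintegral_const_mul' _ _ (by simpa using hZ), ← setLIntegral_const]
  refine lintegral_mono fun b => ?_
  simp only [Pi.mul_apply, Function.comp_apply]
  rw [dens_eq α σ2 γ X T (hns T hT) y, ← ENNReal.ofReal_inv_of_pos hZ,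
    ← ENNReal.ofReal_mul (by positivity), ← ENNReal.ofReal_mul (by positivity),
    ← ENNReal.ofReal_mul (by positivity)]
  refine ENNReal.ofReal_le_ofReal ?_
  rw [GT, cst]
  have eb : ∑ j : T, (embed T b j - lse X T y j) ^ 2 = sqNorm (b - lse X T y) := by
    rw [sqNorm]
    refine Finset.sum_congr rfl fun j _ => ?_
    simp [embed]
  rw [eb, Real.exp_add, Real.exp_add, Real.exp_sub, Real.exp_add, Real.exp_sub, Real.exp_log hZ,
    Real.exp_log hpr, ← hK, Real.exp_log hKpos, Real.exp_log hn]
  have q1 : Real.exp (-(α / (2 * σ2)) * rss X T y) * Real.exp ((α / (2 * σ2)) * rss X T y) = 1 := by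
    rw [← Real.exp_add]; simp
  have q2 : 1 ≤ Real.exp (-((α + γ) / (2 * σ2)) * sqNorm ((XS X T).mulVec (b - lse X T y))) *
      Real.exp ((α + γ) / (2 * σ2) * (T.card * n + 1) * sqNorm (b - lse X T y)) := by
    rw [← Real.exp_add, Real.one_le_exp_iff]
    have h3 := sqNorm_XS_le X hstd T (b - lse X T y)
    have h4 := sqNorm_nonneg (b - lse X T y)
    have h5 : 0 ≤ (α + γ) / (2 * σ2) := by positivity
    have h6 := mul_le_mul_of_nonneg_left h3 h5
    have h7 := mul_nonneg h5 h4
    nlinarith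
  set E1 := Real.exp (-(α / (2 * σ2)) * rss X T y)
  set E2 := Real.exp ((α / (2 * σ2)) * rss X T y)
  set F1 := Real.exp (-((α + γ) / (2 * σ2)) * sqNorm ((XS X T).mulVec (b - lse X T y)))
  set F2 := Real.exp ((α + γ) / (2 * σ2) * (T.card * n + 1) * sqNorm (b - lse X T y))
  have : (Zr α σ2 γ a c X y)⁻¹ * (priorS a c n p T * (nrm σ2 γ X T * E1 * F1 *
      (Zr α σ2 γ a c X y / priorS a c n p T * K / nrm σ2 γ X T * E2 * F2)))
      = K * (E1 * E2) * (F1 * F2) := by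
    field_simp
  rw [this, q1, mul_one]
  exact le_mul_of_one_le_right hKpos.le q2

theorem isProb_mixComp (φ μ : ℝ) (τ2 : ℝ≥0) (hφ : φ ∈ Set.Icc (0 : ℝ) 1) :
    IsProbabilityMeasure (mixComp φ μ τ2) := by
  constructor
  simp only [mixComp, Measure.add_apply, Measure.smul_apply, smul_eq_mul, measure_univ, mul_one]
  rw [← ENNReal.ofReal_add hφ.1 (by linarith [hφ.2])]
  simp

theorem integrable_sq_gauss (μ m : ℝ) (τ2 : ℝ≥0) :
    Integrable (fun x => (x - m) ^ 2) (gaussianReal μ τ2) := by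
  have h1 : MemLp (fun x : ℝ => x) 2 (gaussianReal μ τ2) := memLp_id_gaussianReal' 2 (by simp)
  exact (h1.sub (memLp_const m)).integrable_sq

theorem integrable_sq_mixComp (φ μ m : ℝ) (τ2 : ℝ≥0) :
    Integrable (fun x => (x - m) ^ 2) (mixComp φ μ τ2) := by
  unfold mixComp
  refine Integrable.add_measure ?_ ?_
  · exact (integrable_sq_gauss μ m τ2).smul_measure ENNReal.ofReal_ne_top
  · exact Integrable.smul_measure (integrable_dirac (by simp)) ENNReal.ofReal_ne_top

theorem integral_sq_gauss (μ : ℝ) (τ2 : ℝ≥0) :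
    ∫ x, (x - μ) ^ 2 ∂(gaussianReal μ τ2) = τ2 := by
  have h := variance_fun_id_gaussianReal (μ := μ) (v := τ2)
  rw [variance_eq_integral (by fun_prop)] at h
  simpa using h

theorem integrable_sq_mf {p : ℕ} (φ μ : Fin p → ℝ) (τ2 : Fin p → ℝ≥0)
    (hφ : ∀ j, φ j ∈ Set.Icc (0 : ℝ) 1) (j : Fin p) (m : ℝ) :
    Integrable (fun x : Fin p → ℝ => (x j - m) ^ 2) (meanField φ μ τ2) := by
  have := fun j => isProb_mixComp (φ j) (μ j) (τ2 j) (hφ j)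
  exact integrable_comp_eval (μ := fun j => mixComp (φ j) (μ j) (τ2 j)) (i := j) (f := fun x : ℝ => (x - m) ^ 2)
    (integrable_sq_mixComp (φ j) (μ j) m (τ2 j))

theorem integral_sq_mf {p : ℕ} (φ μ : Fin p → ℝ) (τ2 : Fin p → ℝ≥0)
    (hφ : ∀ j, φ j ∈ Set.Icc (0 : ℝ) 1) (j : Fin p) (h1 : φ j = 1) :
    ∫ x : Fin p → ℝ, (x j - μ j) ^ 2 ∂(meanField φ μ τ2) = τ2 j := by
  have := fun j => isProb_mixComp (φ j) (μ j) (τ2 j) (hφ j)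
  have h2 := integral_comp_eval (μ := fun j => mixComp (φ j) (μ j) (τ2 j)) (i := j)
    (f := fun x : ℝ => (x - μ j) ^ 2)
    (integrable_sq_mixComp (φ j) (μ j) (μ j) (τ2 j)).aestronglyMeasurable
  rw [meanField, h2, mixComp, h1]
  simp [integral_sq_gauss]

theorem integrable_GT_mf (α σ2 γ a c : ℝ) {n p : ℕ} (X : Matrix (Fin n) (Fin p) ℝ)
    (y : Fin n → ℝ) (t2 : Fin p → ℝ≥0) (T : Finset (Fin p))
    (φ μ : Fin p → ℝ) (τ2 : Fin p → ℝ≥0) (hφ : ∀ j, φ j ∈ Set.Icc (0 : ℝ) 1) :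
    Integrable (GT α σ2 γ a c X y t2 T) (meanField φ μ τ2) := by
  have := isProb_meanField φ μ τ2 hφ
  unfold GT
  refine (integrable_const _).add (Integrable.const_mul ?_ _)
  exact integrable_finsetSum _ fun j _ => integrable_sq_mf φ μ τ2 hφ j _

theorem mfG_ae_ne {p : ℕ} (μ : Fin p → ℝ) (τ2 : Fin p → ℝ≥0) (hτ : ∀ j, 0 < τ2 j)
    (T : Finset (Fin p)) : ∀ᵐ b ∂(mfG μ τ2 T), ∀ j, b j ≠ 0 := by
  rw [ae_all_iff]
  intro j
  have h1 : ∀ᵐ x ∂(gaussianReal (μ j) (τ2 j)), x ≠ 0 := by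
    have := nullSingletonClass_gaussianReal (μ := μ j) (hτ j).ne'
    rw [ae_iff]
    simp
  exact (measurePreserving_eval (fun j : T => gaussianReal (μ j) (τ2 j)) j).quasiMeasurePreserving.ae h1

theorem mfW_zero (α σ2 γ a c : ℝ) (hσ2 : 0 < σ2) (hα : 0 < α) (hγ : 0 < γ) (hc : 0 < c)
    {n p : ℕ} (hp : 0 < p) (X : Matrix (Fin n) (Fin p) ℝ)
    (hns : ∀ S : Finset (Fin p), S.card ≤ n → IsUnit (gram X S).det) (y : Fin n → ℝ)
    (φ μ : Fin p → ℝ) (τ2 : Fin p → ℝ≥0) (hτ : ∀ j, 0 < τ2 j)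
    (hac : meanField φ μ τ2 ≪ post α σ2 γ a c X y) (T : Finset (Fin p)) (hT : ¬ T.card ≤ n) :
    mfW φ T = 0 := by
  have h0 : post α σ2 γ a c X y {b | (n : ℝ) < ((config b).card : ℝ)} = 0 := by
    refine le_antisymm ((post_tail α σ2 γ a c hσ2 hα hγ hc hp X hns y n).trans_eq ?_) zero_le
    rw [Finset.sum_eq_zero]
    · simp
    · intro S _
      split_ifs with h
      · rw [priorS_zero a c n p S (by exact_mod_cast not_le.2 h), zero_mul]
      · rfl
  have h1 := hac h0
  rw [meanField_eq_sum] at h1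
  have h2 := (Measure.sum_apply_eq_zero.1 h1) T
  rw [Measure.smul_apply, smul_eq_mul, Measure.map_apply (measurable_embed T)
    (measurableSet_config_card _)] at h2
  have h3 : mfG μ τ2 T (embed T ⁻¹' {b | (n : ℝ) < ((config b).card : ℝ)}) = 1 := by
    rw [prob_compl_eq_zero_iff (measurable_embed T (measurableSet_config_card _)) |>.symm]
    rw [← mem_ae_iff]
    filter_upwards [mfG_ae_ne μ τ2 hτ T] with b hb
    simp only [Set.mem_preimage, Set.mem_ofPred_eq]
    rw [config_embed_eq T b hb]
    exact_mod_cast not_le.1 hT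
  rwa [h3, mul_one] at h2

theorem mf_llr (α σ2 γ a c : ℝ) (hσ2 : 0 < σ2) (hα : 0 < α) (hγ : 0 < γ) (hc : 0 < c)
    {n p : ℕ} (hp : 0 < p) (X : Matrix (Fin n) (Fin p) ℝ)
    (hstd : ∀ j, ∑ i, X i j ^ 2 = (n : ℝ))
    (hns : ∀ S : Finset (Fin p), S.card ≤ n → IsUnit (gram X S).det) (y : Fin n → ℝ)
    (φ μ : Fin p → ℝ) (τ2 : Fin p → ℝ≥0) (hφ : ∀ j, φ j ∈ Set.Icc (0 : ℝ) 1)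
    (hτ : ∀ j, 0 < τ2 j)
    (hac : meanField φ μ τ2 ≪ post α σ2 γ a c X y) :
    Integrable (fun x => Real.log ((meanField φ μ τ2).rnDeriv (post α σ2 γ a c X y) x).toReal)
      (meanField φ μ τ2) := by
  have i1 := isProb_meanField φ μ τ2 hφ
  have i2 := isProb_post α σ2 γ a c hσ2 hα hγ hc hp X hns y
  set G := GT α σ2 γ a c X y τ2 with hG
  have hGm : ∀ T, Measurable (G T) := fun T => measurable_GT α σ2 γ a c X y τ2 T
  set B : ℝ := ∑ _T : Finset (Fin p), (1 : ℝ) with hB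
  have hB1 : 0 < B := by rw [hB]; simp
  set H : (Fin p → ℝ) → ℝ := fun x => ∑ T : Finset (Fin p), |G T x| + Real.log B with hH
  have hHi : Integrable H (meanField φ μ τ2) := by
    refine Integrable.add ?_ (integrable_const _)
    exact integrable_finsetSum _ fun T _ =>
      (integrable_GT_mf α σ2 γ a c X y τ2 T φ μ τ2 hφ).abs
  refine (KL_bound _ (post α σ2 γ a c X y) H hHi ?_).2.1
  rw [Measure.le_iff]
  intro s hs
  rw [meanField_eq_sum, Measure.sum_apply _ hs, tsum_fintype, withDensity_apply _ hs]
  have hW : ∀ T, mfW φ T ≤ 1 := by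
    intro T
    refine mul_le_one' (Finset.prod_le_one' fun j _ => ?_) (Finset.prod_le_one' fun j _ => ?_)
    · exact ENNReal.ofReal_le_one.2 (hφ j).2
    · exact ENNReal.ofReal_le_one.2 (by linarith [(hφ j).1])
  have h1 : ∀ T, (mfW φ T • (mfG μ τ2 T).map (embed T)) s ≤
      ∫⁻ x in s, ENNReal.ofReal (Real.exp (∑ T : Finset (Fin p), |G T x|))
        ∂(post α σ2 γ a c X y) := by
    intro T
    by_cases hT : T.card ≤ n
    · rw [Measure.smul_apply, smul_eq_mul]
      refine (mul_le_of_le_one_left zero_le (hW T)).trans ?_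
      refine (comp_le α σ2 γ a c hσ2 hα hγ hc hp X hstd hns y μ τ2 hτ T hT s).trans ?_
      rw [withDensity_apply _ hs]
      refine lintegral_mono fun x => ENNReal.ofReal_le_ofReal (Real.exp_le_exp.2 ?_)
      refine (le_abs_self _).trans ?_
      exact Finset.single_le_sum (f := fun T => |G T x|) (fun _ _ => abs_nonneg _)
        (Finset.mem_univ T)
    · rw [mfW_zero α σ2 γ a c hσ2 hα hγ hc hp X hns y φ μ τ2 hτ hac T hT]
      simp
  refine (Finset.sum_le_sum fun T _ => h1 T).trans_eq ?_
  rw [Finset.sum_const, nsmul_eq_mul]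
  have e : ∀ x, ENNReal.ofReal (Real.exp (H x)) =
      ENNReal.ofReal B * ENNReal.ofReal (Real.exp (∑ T : Finset (Fin p), |G T x|)) := by
    intro x
    rw [hH, Real.exp_add, Real.exp_log hB1, mul_comm, ENNReal.ofReal_mul hB1.le]
  simp_rw [e]
  rw [lintegral_const_mul' _ _ ENNReal.ofReal_ne_top]
  congr 1
  rw [hB]
  simp

theorem mf_ind {p : ℕ} (S : Finset (Fin p)) (μ : Fin p → ℝ) (τ2 : Fin p → ℝ≥0) :
    meanField (fun j => if j ∈ S then (1 : ℝ) else 0) μ τ2 = (mfG μ τ2 S).map (embed S) := by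
  rw [meanField_eq_sum]
  ext s hs
  rw [Measure.sum_apply _ hs, tsum_fintype, Finset.sum_eq_single S]
  · have : mfW (fun j => if j ∈ S then (1 : ℝ) else 0) S = 1 := by
      unfold mfW
      rw [Finset.prod_eq_one, Finset.prod_eq_one, one_mul]
      · intro j hj
        have : j ∉ S := (Finset.mem_sdiff.1 hj).2
        simp [this]
      · intro j hj
        simp [hj]
    rw [this, one_smul]
  · intro T _ hTS
    have : mfW (fun j => if j ∈ S then (1 : ℝ) else 0) T = 0 := by
      unfold mfW
      by_cases h : T ⊆ S
      · obtain ⟨j, hjS, hjT⟩ : ∃ j ∈ S, j ∉ T := by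
          by_contra hcon
          push Not at hcon
          exact hTS (Finset.Subset.antisymm h hcon)
        rw [mul_eq_zero]
        right
        exact Finset.prod_eq_zero (i := j) (by simp [hjT]) (by simp [hjS])
      · obtain ⟨j, hjT, hjS⟩ := Finset.not_subset.1 h
        rw [mul_eq_zero]
        left
        exact Finset.prod_eq_zero (i := j) hjT (by simp [hjS])
    rw [this, zero_smul]
    rfl
  · simp

/-- The variance used for the trial distribution. -/
def tau (α σ2 γ : ℝ) (n k : ℕ) : ℝ := σ2 / ((k * n + 1) * (α + γ))

theorem tau_pos (α σ2 γ : ℝ) (hσ2 : 0 < σ2) (hα : 0 < α) (hγ : 0 < γ) (n k : ℕ) :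
    0 < tau α σ2 γ n k := by unfold tau; positivity

theorem pointwise (α σ2 γ a c : ℝ) (hσ2 : 0 < σ2) (hα : 0 < α) (hγ : 0 < γ) (hc : 0 < c)
    {n p : ℕ} (hp : 0 < p) (X : Matrix (Fin n) (Fin p) ℝ)
    (hstd : ∀ j, ∑ i, X i j ^ 2 = (n : ℝ))
    (hns : ∀ S : Finset (Fin p), S.card ≤ n → IsUnit (gram X S).det) (y : Fin n → ℝ)
    (q : Measure (Fin p → ℝ)) (hq : IsVarApprox q (post α σ2 γ a c X y))
    (S : Finset (Fin p)) (hS : S.card ≤ n) (m κ : ℝ) :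
    κ * (q {b | m < ((config b).card : ℝ)}).toReal ≤
      cst α σ2 γ a c X y (fun _ => (tau α σ2 γ n S.card).toNNReal) S + S.card / 2
      + Real.exp κ * (post α σ2 γ a c X y {b | m < ((config b).card : ℝ)}).toReal := by
  have i2 := isProb_post α σ2 γ a c hσ2 hα hγ hc hp X hns y
  set φ' : Fin p → ℝ := fun j => if j ∈ S then (1 : ℝ) else 0 with hφ'
  have hφ1 : ∀ j, φ' j ∈ Set.Icc (0 : ℝ) 1 := by
    intro j
    rw [hφ']
    dsimp only
    split_ifs <;> simp
  have ht := tau_pos α σ2 γ hσ2 hα hγ n S.card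
  set τ2 : Fin p → ℝ≥0 := fun _ => (tau α σ2 γ n S.card).toNNReal with hτ2
  have hτ : ∀ j, 0 < τ2 j := fun j => by simpa [hτ2] using ht
  set μ' : Fin p → ℝ := embed S (lse X S y) with hμ'
  have i1 := isProb_meanField φ' μ' τ2 hφ1
  have hmem : meanField φ' μ' τ2 ∈ MeanFieldFamily p := ⟨φ', μ', τ2, hφ1, hτ, rfl⟩
  have hle : meanField φ' μ' τ2 ≤ (post α σ2 γ a c X y).withDensity
      (fun x => ENNReal.ofReal (Real.exp (GT α σ2 γ a c X y τ2 S x))) := by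
    rw [hφ', mf_ind]
    exact comp_le α σ2 γ a c hσ2 hα hγ hc hp X hstd hns y μ' τ2 hτ S hS
  obtain ⟨hac', hint', hb⟩ := KL_bound _ (post α σ2 γ a c X y) _
    (integrable_GT_mf α σ2 γ a c X y τ2 S φ' μ' τ2 hφ1) hle
  have hGint : ∫ x, GT α σ2 γ a c X y τ2 S x ∂(meanField φ' μ' τ2)
      = cst α σ2 γ a c X y τ2 S + S.card / 2 := by
    unfold GT
    have hi : ∀ j : S, Integrable (fun x : Fin p → ℝ => (x j - lse X S y j) ^ 2)
        (meanField φ' μ' τ2) := fun j => integrable_sq_mf φ' μ' τ2 hφ1 j _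
    have hi2 : Integrable (fun x : Fin p → ℝ => ((α + γ) / (2 * σ2)) * (S.card * n + 1) *
        ∑ j : S, (x j - lse X S y j) ^ 2) (meanField φ' μ' τ2) :=
      Integrable.const_mul (integrable_finsetSum _ fun j _ => hi j) _
    rw [integral_add (integrable_const _) hi2,
      integral_const_mul, integral_finsetSum _ (fun j _ => hi j)]
    have e : ∀ j : S, ∫ x : Fin p → ℝ, (x j - lse X S y j) ^ 2 ∂(meanField φ' μ' τ2)
        = tau α σ2 γ n S.card := by
      intro j
      have h1 : lse X S y j = μ' j := by simp [hμ', embed]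
      rw [h1, integral_sq_mf φ' μ' τ2 hφ1 j (by simp [hφ'])]
      simp [hτ2, ht.le]
    simp_rw [e]
    simp only [integral_const, Finset.sum_const, Finset.card_univ, Fintype.card_coe, nsmul_eq_mul,
      smul_eq_mul, probReal_univ, one_mul]
    unfold tau
    field_simp
  obtain ⟨⟨φ, μ, τ, hφ, hτ0, rfl⟩, hmin⟩ := hq
  have hk := hmin _ hmem
  have hac : meanField φ μ τ ≪ post α σ2 γ a c X y := by
    by_contra hcon
    rw [KL, KL, if_neg hcon, if_pos hac'] at hk
    exact absurd hk (by simp)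
  rw [KL, KL, if_pos hac, if_pos hac', EReal.coe_le_coe_iff] at hk
  have i3 := isProb_meanField φ μ τ hφ
  have hint := mf_llr α σ2 γ a c hσ2 hα hγ hc hp X hstd hns y φ μ τ hφ hτ0 hac
  have hdv := DV _ _ hac hint {b | m < ((config b).card : ℝ)} (measurableSet_config_card m) κ
  have hP : 0 ≤ (post α σ2 γ a c X y {b | m < ((config b).card : ℝ)}).toReal :=
    ENNReal.toReal_nonneg
  nlinarith

theorem gauss_one (α σ2 : ℝ) (hσ2 : 0 < σ2) (m w : ℝ) :
    Integrable (fun x => Real.exp (α / (2 * σ2) * ((x - m) ^ 2 - (x - w) ^ 2)))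
      (gaussianReal m σ2.toNNReal) ∧
    ∫ x, Real.exp (α / (2 * σ2) * ((x - m) ^ 2 - (x - w) ^ 2)) ∂(gaussianReal m σ2.toNNReal)
      = Real.exp (-(α / (2 * σ2) * (1 - α)) * (m - w) ^ 2) := by
  have e : ∀ x : ℝ, Real.exp (α / (2 * σ2) * ((x - m) ^ 2 - (x - w) ^ 2))
      = Real.exp (α / (2 * σ2) * (m ^ 2 - w ^ 2)) * Real.exp (α / σ2 * (w - m) * x) := by
    intro x
    rw [← Real.exp_add]
    congr 1
    field_simp
    ring
  simp_rw [e]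
  constructor
  · exact (integrable_exp_mul_gaussianReal _).const_mul _
  · rw [integral_const_mul]
    have h := congrFun (mgf_fun_id_gaussianReal (μ := m) (v := σ2.toNNReal)) (α / σ2 * (w - m))
    rw [mgf] at h
    rw [h, ← Real.exp_add, Real.coe_toNNReal _ hσ2.le]
    congr 1
    field_simp
    ring

theorem gauss_multi (α σ2 : ℝ) (hσ2 : 0 < σ2) {n : ℕ} (m w : Fin n → ℝ) :
    ∫⁻ y : Fin n → ℝ, ENNReal.ofReal (Real.exp (α / (2 * σ2) * (sqNorm (y - m) - sqNorm (y - w))))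
      ∂(Measure.pi fun i => gaussianReal (m i) σ2.toNNReal)
      = ENNReal.ofReal (Real.exp (-(α / (2 * σ2) * (1 - α)) * sqNorm (m - w))) := by
  have e : ∀ y : Fin n → ℝ, Real.exp (α / (2 * σ2) * (sqNorm (y - m) - sqNorm (y - w)))
      = ∏ i, Real.exp (α / (2 * σ2) * ((y i - m i) ^ 2 - (y i - w i) ^ 2)) := by
    intro y
    rw [← Real.exp_sum, sqNorm, sqNorm, ← Finset.sum_sub_distrib, Finset.mul_sum]
    rfl
  simp_rw [e]
  rw [← ofReal_integral_eq_lintegral_ofReal]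
  · rw [integral_fintype_prod_eq_prod
      (fun i x => Real.exp (α / (2 * σ2) * ((x - m i) ^ 2 - (x - w i) ^ 2)))]
    simp_rw [(gauss_one α σ2 hσ2 _ _).2]
    rw [← Real.exp_sum, sqNorm, Finset.mul_sum]
    rfl
  · exact Integrable.fintype_prod
      (f := fun i x => Real.exp (α / (2 * σ2) * ((x - m i) ^ 2 - (x - w i) ^ 2)))
      (fun i => (gauss_one α σ2 hσ2 _ _).1)
  · exact Eventually.of_forall fun b => Finset.prod_nonneg fun i _ => (Real.exp_pos _).le

/-- Likelihood-ratio type statistic. -/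
def ES (α σ2 : ℝ) {n p : ℕ} (X : Matrix (Fin n) (Fin p) ℝ) (β : Fin p → ℝ)
    (S : Finset (Fin p)) (y : Fin n → ℝ) : ℝ :=
  Real.exp (α / (2 * σ2) * (sqNorm (y - X.mulVec β) - rss X S y))

theorem measurable_rss {n p : ℕ} (X : Matrix (Fin n) (Fin p) ℝ) (S : Finset (Fin p)) :
    Measurable (rss X S) := by
  unfold rss lse
  refine measurable_sqNorm.comp (measurable_id.sub ?_)
  exact (measurable_mulVec _).comp ((measurable_mulVec _).comp (measurable_mulVec _))

theorem measurable_ES (α σ2 : ℝ) {n p : ℕ} (X : Matrix (Fin n) (Fin p) ℝ) (β : Fin p → ℝ)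
    (S : Finset (Fin p)) : Measurable (ES α σ2 X β S) := by
  unfold ES
  refine Measurable.exp (Measurable.const_mul (Measurable.sub ?_ (measurable_rss X S)) _)
  exact measurable_sqNorm.comp (measurable_id.sub measurable_const)

theorem expect_ES (α σ2 : ℝ) (hσ2 : 0 < σ2) (hα : 0 < α) (hα1 : α < 1) {n p : ℕ}
    (X : Matrix (Fin n) (Fin p) ℝ) (β : Fin p → ℝ)
    (S : Finset (Fin p)) (hdet : IsUnit (gram X S).det) :
    ∫⁻ y, ENNReal.ofReal (ES α σ2 X β S y) ∂(dataDist σ2 X β)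
      ≤ ENNReal.ofReal (Real.sqrt (1 / (1 - α)) ^ S.card) := by
  set t := α / (2 * σ2) with ht
  have ht0 : 0 < t := by positivity
  have h1α : 0 < 1 - α := by linarith
  have hd := det_gram_pos X S hdet
  set K : ℝ := (Real.sqrt (π / t)) ^ S.card * (Real.sqrt (gram X S).det)⁻¹ with hK
  have hK0 : 0 < K := by positivity
  have h1 : ∀ y, ENNReal.ofReal (ES α σ2 X β S y) * ENNReal.ofReal K
      = ∫⁻ b : S → ℝ, ENNReal.ofReal (Real.exp (t * (sqNorm (y - X.mulVec β)
          - sqNorm (y - (XS X S).mulVec b)))) := by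
    intro y
    rw [hK, ← lintegral_gauss X S hdet (lse X S y) t ht0,
      ← lintegral_const_mul' _ _ ENNReal.ofReal_ne_top]
    refine lintegral_congr fun b => ?_
    rw [ES, ← ENNReal.ofReal_mul (Real.exp_pos _).le, ← Real.exp_add, pythag X S hdet, ← rss]
    congr 2
    ring
  have hfin : IsProbabilityMeasure (dataDist σ2 X β) := by unfold dataDist; infer_instance
  have h2 : (∫⁻ y, ENNReal.ofReal (ES α σ2 X β S y) ∂(dataDist σ2 X β)) * ENNReal.ofReal K
      ≤ ENNReal.ofReal (Real.sqrt (1 / (1 - α)) ^ S.card) * ENNReal.ofReal K := by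
    rw [← lintegral_mul_const' _ _ ENNReal.ofReal_ne_top]
    simp_rw [h1]
    rw [lintegral_lintegral_swap]
    · simp_rw [dataDist, ht, gauss_multi α σ2 hσ2]
      rw [← ht]
      calc _ ≤ ∫⁻ b : S → ℝ, ENNReal.ofReal (Real.exp (-(t * (1 - α)) *
              sqNorm ((XS X S).mulVec (b - lse X S (X.mulVec β))))) := by
            refine lintegral_mono fun b => ENNReal.ofReal_le_ofReal (Real.exp_le_exp.2 ?_)
            have h3 := pythag X S hdet (X.mulVec β) b
            have h4 := sqNorm_nonneg (X.mulVec β - (XS X S).mulVec (lse X S (X.mulVec β)))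
            have h5 : 0 < t * (1 - α) := by positivity
            nlinarith
        _ = _ := by
            rw [lintegral_gauss X S hdet _ _ (by positivity), ← ENNReal.ofReal_mul (by positivity),
              hK, ← mul_assoc, ← mul_pow, ← Real.sqrt_mul (by positivity)]
            congr 5
            field_simp
    · refine Measurable.aemeasurable ?_
      refine (Measurable.exp (Measurable.const_mul (Measurable.sub ?_ ?_) _)).ennreal_ofReal
      · exact measurable_sqNorm.comp (measurable_fst.sub measurable_const)
      · exact measurable_sqNorm.comp (measurable_fst.sub ((measurable_mulVec _).comp measurable_snd))
  exact (ENNReal.mul_le_mul_iff_left (by simpa using hK0) ENNReal.ofReal_ne_top).1 h2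

theorem rss_le {n p : ℕ} (X : Matrix (Fin n) (Fin p) ℝ) (β : Fin p → ℝ)
    (hdet : IsUnit (gram X (config β)).det) (y : Fin n → ℝ) :
    rss X (config β) y ≤ sqNorm (y - X.mulVec β) := by
  have e : X.mulVec β = (XS X (config β)).mulVec (fun j => β j) := by
    ext i
    simp only [Matrix.mulVec, dotProduct, XS, Matrix.of_apply]
    rw [Finset.sum_coe_sort (config β) (fun j => X i j * β j)]
    symm
    refine Finset.sum_subset (Finset.subset_univ _) fun j _ hj => ?_
    rw [mem_config, not_not] at hj
    simp [hj]
  rw [e, pythag X _ hdet, rss]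
  linarith [sqNorm_nonneg ((XS X (config β)).mulVec ((fun j : config β => β j) - lse X (config β) y))]

/-- Weighted sum of likelihood ratios over configurations of size larger than `m`. -/
def RR (α σ2 a c : ℝ) {n p : ℕ} (X : Matrix (Fin n) (Fin p) ℝ) (β : Fin p → ℝ) (m : ℝ)
    (y : Fin n → ℝ) : ℝ :=
  ∑ S : Finset (Fin p), if m < (S.card : ℝ) then
    priorSWt a c n p S / priorSWt a c n p (config β) * ES α σ2 X β S y else 0

/-- Upper bound for the expectation of `RR`. -/
def LL (α a c : ℝ) (n p : ℕ) (S0 : Finset (Fin p)) (m : ℝ) : ℝ :=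
  ∑ S : Finset (Fin p), if m < (S.card : ℝ) then
    priorSWt a c n p S / priorSWt a c n p S0 * Real.sqrt (1 / (1 - α)) ^ S.card else 0

theorem integrable_ES (α σ2 : ℝ) (hσ2 : 0 < σ2) (hα : 0 < α) (hα1 : α < 1) {n p : ℕ}
    (X : Matrix (Fin n) (Fin p) ℝ) (β : Fin p → ℝ)
    (S : Finset (Fin p)) (hdet : IsUnit (gram X S).det) :
    Integrable (ES α σ2 X β S) (dataDist σ2 X β) ∧
      ∫ y, ES α σ2 X β S y ∂(dataDist σ2 X β) ≤ Real.sqrt (1 / (1 - α)) ^ S.card := by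
  have h := expect_ES α σ2 hσ2 hα hα1 X β S hdet
  have hm := measurable_ES α σ2 X β S
  have hpos : ∀ y, 0 ≤ ES α σ2 X β S y := fun y => (Real.exp_pos _).le
  constructor
  · refine ⟨hm.aestronglyMeasurable, ?_⟩
    rw [hasFiniteIntegral_iff_ofReal (Eventually.of_forall hpos)]
    exact h.trans_lt ENNReal.ofReal_lt_top
  · rw [integral_eq_lintegral_of_nonneg_ae (Eventually.of_forall hpos) hm.aestronglyMeasurable]
    exact ENNReal.toReal_le_of_le_ofReal (by positivity) h

theorem integrable_RR (α σ2 a c : ℝ) (hσ2 : 0 < σ2) (hα : 0 < α) (hα1 : α < 1) (hc : 0 < c)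
    {n p : ℕ} (X : Matrix (Fin n) (Fin p) ℝ)
    (hns : ∀ S : Finset (Fin p), S.card ≤ n → IsUnit (gram X S).det) (β : Fin p → ℝ) (m : ℝ) :
    Integrable (RR α σ2 a c X β m) (dataDist σ2 X β) ∧
      ∫ y, RR α σ2 a c X β m y ∂(dataDist σ2 X β) ≤ LL α a c n p (config β) m := by
  have key : ∀ S : Finset (Fin p), Integrable (fun y => if m < (S.card : ℝ) then
      priorSWt a c n p S / priorSWt a c n p (config β) * ES α σ2 X β S y else 0)
        (dataDist σ2 X β) ∧ ∫ y, (if m < (S.card : ℝ) then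
      priorSWt a c n p S / priorSWt a c n p (config β) * ES α σ2 X β S y else 0)
        ∂(dataDist σ2 X β) ≤ if m < (S.card : ℝ) then
      priorSWt a c n p S / priorSWt a c n p (config β) * Real.sqrt (1 / (1 - α)) ^ S.card
        else 0 := by
    intro S
    split_ifs with h
    · by_cases hS : S.card ≤ n
      · obtain ⟨h1, h2⟩ := integrable_ES α σ2 hσ2 hα hα1 X β S (hns S hS)
        refine ⟨h1.const_mul _, ?_⟩
        rw [integral_const_mul]
        exact mul_le_mul_of_nonneg_left h2
          (div_nonneg (wt_nonneg a c hc n p S) (wt_nonneg a c hc n p _))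
      · have : priorSWt a c n p S = 0 := by simp [priorSWt, hS]
        simp [this]
    · simp
  unfold RR LL
  refine ⟨integrable_finsetSum _ fun S _ => (key S).1, ?_⟩
  rw [integral_finsetSum _ fun S _ => (key S).1]
  exact Finset.sum_le_sum fun S _ => (key S).2

theorem RR_nonneg (α σ2 a c : ℝ) (hc : 0 < c) {n p : ℕ} (X : Matrix (Fin n) (Fin p) ℝ)
    (β : Fin p → ℝ) (m : ℝ) (y : Fin n → ℝ) : 0 ≤ RR α σ2 a c X β m y := by
  refine Finset.sum_nonneg fun S _ => ?_
  split_ifs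
  · exact mul_nonneg (div_nonneg (wt_nonneg a c hc n p S) (wt_nonneg a c hc n p _))
      (Real.exp_pos _).le
  · exact le_rfl

theorem prior_ratio (a c : ℝ) (hc : 0 < c) (n p : ℕ) (hp : 0 < p) (S S0 : Finset (Fin p)) :
    priorS a c n p S / priorS a c n p S0 = priorSWt a c n p S / priorSWt a c n p S0 := by
  have := wt_sum_pos a c hc n p hp
  unfold priorS
  rw [div_div_div_cancel_right₀ this.ne']

theorem nu_le (α γ : ℝ) (hα : 0 < α) (hγ : 0 < γ) (k : ℕ) :
    Real.sqrt (γ / (α + γ)) ^ k ≤ 1 := by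
  refine pow_le_one₀ (Real.sqrt_nonneg _) ?_
  rw [Real.sqrt_le_one]
  rw [div_le_one (by positivity)]
  linarith

theorem term_le (α σ2 γ a c : ℝ) (hα : 0 < α) (hγ : 0 < γ) (hc : 0 < c)
    {n p : ℕ} (hp : 0 < p) (X : Matrix (Fin n) (Fin p) ℝ) (β : Fin p → ℝ)
    (y : Fin n → ℝ) (m : ℝ) :
    (∑ S : Finset (Fin p), if m < (S.card : ℝ) then
          priorS a c n p S * mass α σ2 γ X S y else 0) / priorS a c n p (config β) *
      Real.exp (α / (2 * σ2) * sqNorm (y - X.mulVec β)) ≤ RR α σ2 a c X β m y := by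
  unfold RR
  rw [Finset.sum_div, Finset.sum_mul]
  refine Finset.sum_le_sum fun S _ => ?_
  split_ifs
  · rw [← prior_ratio a c hc n p hp, ES, mul_sub, Real.exp_sub, mass]
    have h1 := nu_le α γ hα hγ S.card
    have h2 : 0 ≤ priorS a c n p S / priorS a c n p (config β) :=
      div_nonneg (priorS_nonneg a c hc n p S) (priorS_nonneg a c hc n p _)
    have e : priorS a c n p S * (Real.sqrt (γ / (α + γ)) ^ S.card *
          Real.exp (-(α / (2 * σ2)) * rss X S y)) / priorS a c n p (config β) *
        Real.exp (α / (2 * σ2) * sqNorm (y - X.mulVec β))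
        = Real.sqrt (γ / (α + γ)) ^ S.card * (priorS a c n p S / priorS a c n p (config β) *
          (Real.exp (α / (2 * σ2) * sqNorm (y - X.mulVec β)) /
            Real.exp (α / (2 * σ2) * rss X S y))) := by
      rw [neg_mul, Real.exp_neg]
      ring
    rw [e]
    exact mul_le_of_le_one_left (by positivity) h1
  · simp

theorem expect_bound (α σ2 γ a c : ℝ) (hσ2 : 0 < σ2) (hα : 0 < α) (hα1 : α < 1) (hγ : 0 < γ)
    (hc : 0 < c) {n p : ℕ} (hp : 0 < p) (X : Matrix (Fin n) (Fin p) ℝ)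
    (hstd : ∀ j, ∑ i, X i j ^ 2 = (n : ℝ))
    (hns : ∀ S : Finset (Fin p), S.card ≤ n → IsUnit (gram X S).det)
    (q : (Fin n → ℝ) → Measure (Fin p → ℝ))
    (hq : ∀ y, IsVarApprox (q y) (post α σ2 γ a c X y))
    (β : Fin p → ℝ) (hS : (config β).card ≤ n) (m κ : ℝ) (hκ : 0 < κ) :
    ENNReal.ofReal κ * ∫⁻ y, q y {b | m < ((config b).card : ℝ)} ∂(dataDist σ2 X β) ≤
      ENNReal.ofReal (Real.log (LL α a c n p (config β) (-1))
        + ((config β).card / 2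
          + Real.log (∏ _j : config β, (Real.sqrt (2 * π * tau α σ2 γ n (config β).card))⁻¹)
          - Real.log (nrm σ2 γ X (config β)))
        + Real.exp κ * ((Real.sqrt (γ / (α + γ)) ^ (config β).card)⁻¹
          * LL α a c n p (config β) m)) := by
  have hfin : IsProbabilityMeasure (dataDist σ2 X β) := by unfold dataDist; infer_instance
  set k := (config β).card with hk
  have ht := tau_pos α σ2 γ hσ2 hα hγ n k
  set Dk : ℝ := (k / 2
          + Real.log (∏ _j : config β, (Real.sqrt (2 * π * tau α σ2 γ n k))⁻¹)
          - Real.log (nrm σ2 γ X (config β))) with hDk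
  set ν := Real.sqrt (γ / (α + γ)) ^ k with hν
  have hν0 : 0 < ν := by rw [hν]; positivity
  obtain ⟨hR1, hR2⟩ := integrable_RR α σ2 a c hσ2 hα hα1 hc X hns β (-1)
  obtain ⟨hA1, hA2⟩ := integrable_RR α σ2 a c hσ2 hα hα1 hc X hns β m
  set L := LL α a c n p (config β) (-1) with hL
  have hpr := priorS_pos a c hc n p hp (config β) hS
  have hw := wt_pos a c hc n p hp (config β) hS
  have h1α : 0 < 1 - α := by linarith
  have hL0 : 0 < L := by
    rw [hL, LL]
    refine Finset.sum_pos' (fun S _ => ?_) ⟨config β, Finset.mem_univ _, ?_⟩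
    · split_ifs
      · exact mul_nonneg (div_nonneg (wt_nonneg a c hc n p S) hw.le) (by positivity)
      · exact le_rfl
    · rw [if_pos (by linarith [Nat.cast_nonneg (α := ℝ) (config β).card])]
      positivity
  set U : (Fin n → ℝ) → ℝ := fun y => (Real.log L - 1 + Dk) + RR α σ2 a c X β (-1) y / L
    + Real.exp κ * (ν⁻¹ * RR α σ2 a c X β m y) with hU
  have hUi : Integrable U (dataDist σ2 X β) :=
    ((integrable_const _).add (hR1.div_const L)).add ((hA1.const_mul _).const_mul _)
  have hpt : ∀ y, κ * (q y {b | m < ((config b).card : ℝ)}).toReal ≤ U y := by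
    intro y
    have h := pointwise α σ2 γ a c hσ2 hα hγ hc hp X hstd hns y (q y) (hq y) (config β) hS m κ
    have hZ := Zr_pos α σ2 γ a c hα hγ hc hp X y
    have hrss := rss_le X β (hns _ hS) y
    have hα2 : 0 < α / (2 * σ2) := by positivity
    have hrs2 := mul_le_mul_of_nonneg_left hrss hα2.le
    have hcst : cst α σ2 γ a c X y (fun _ => (tau α σ2 γ n k).toNNReal) (config β) + k / 2
        ≤ Real.log L - 1 + Dk + RR α σ2 a c X β (-1) y / L := by
      have hz := term_le α σ2 γ a c hα hγ hc hp X β y (-1)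
      have e1 : (∑ S : Finset (Fin p), if (-1 : ℝ) < (S.card : ℝ) then
          priorS a c n p S * mass α σ2 γ X S y else 0) = Zr α σ2 γ a c X y := by
        refine Finset.sum_congr rfl fun S _ => ?_
        rw [if_pos (by linarith [Nat.cast_nonneg (α := ℝ) S.card])]
      rw [e1] at hz
      have hpos : 0 < Zr α σ2 γ a c X y / priorS a c n p (config β) *
        Real.exp (α / (2 * σ2) * sqNorm (y - X.mulVec β)) := by positivity
      have hl1 := Real.log_le_log hpos hz
      rw [Real.log_mul (by positivity) (Real.exp_pos _).ne', Real.log_exp,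
        Real.log_div hZ.ne' hpr.ne'] at hl1
      have hRpos := hpos.trans_le hz
      have hl2 := Real.log_le_sub_one_of_pos (div_pos hRpos hL0)
      rw [Real.log_div hRpos.ne' hL0.ne'] at hl2
      rw [cst, hDk, Real.coe_toNNReal _ ht.le]
      linarith
    have hpost : (post α σ2 γ a c X y {b | m < ((config b).card : ℝ)}).toReal
        ≤ ν⁻¹ * RR α σ2 a c X β m y := by
      have hRn := RR_nonneg α σ2 a c hc X β m y
      refine ENNReal.toReal_le_of_le_ofReal (by positivity) ?_
      refine (post_tail α σ2 γ a c hσ2 hα hγ hc hp X hns y m).trans (ENNReal.ofReal_le_ofReal ?_)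
      have hz := term_le α σ2 γ a c hα hγ hc hp X β y m
      set Q := (∑ S : Finset (Fin p), if m < (S.card : ℝ) then
          priorS a c n p S * mass α σ2 γ X S y else 0) with hQ
      have hQ0 : 0 ≤ Q := by
        refine Finset.sum_nonneg fun S _ => ?_
        split_ifs
        · exact mul_nonneg (priorS_nonneg a c hc n p S) (mass_pos α σ2 γ hα hγ X S y).le
        · exact le_rfl
      have hZ2 : priorS a c n p (config β) * (ν *
          Real.exp (-(α / (2 * σ2)) * sqNorm (y - X.mulVec β))) ≤ Zr α σ2 γ a c X y := by
        have h5 : priorS a c n p (config β) * mass α σ2 γ X (config β) y ≤ Zr α σ2 γ a c X y :=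
          Finset.single_le_sum (f := fun S => priorS a c n p S * mass α σ2 γ X S y)
            (fun S _ => mul_nonneg (priorS_nonneg a c hc n p S) (mass_pos α σ2 γ hα hγ X S y).le)
            (Finset.mem_univ (config β))
        refine le_trans ?_ h5
        rw [mass]
        have h6 : Real.exp (-(α / (2 * σ2)) * sqNorm (y - X.mulVec β)) ≤
            Real.exp (-(α / (2 * σ2)) * rss X (config β) y) := Real.exp_le_exp.2 (by linarith)
        gcongr
      have h7 : (Zr α σ2 γ a c X y)⁻¹ ≤ (priorS a c n p (config β) * (ν *
          Real.exp (-(α / (2 * σ2)) * sqNorm (y - X.mulVec β))))⁻¹ :=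
        inv_anti₀ (by positivity) hZ2
      calc (Zr α σ2 γ a c X y)⁻¹ * Q ≤ (priorS a c n p (config β) * (ν *
          Real.exp (-(α / (2 * σ2)) * sqNorm (y - X.mulVec β))))⁻¹ * Q :=
            mul_le_mul_of_nonneg_right h7 hQ0
        _ = ν⁻¹ * (Q / priorS a c n p (config β) *
              Real.exp (α / (2 * σ2) * sqNorm (y - X.mulVec β))) := by
            rw [neg_mul, Real.exp_neg]
            field_simp
        _ ≤ _ := mul_le_mul_of_nonneg_left hz (by positivity)
    have h8 := mul_le_mul_of_nonneg_left hpost (Real.exp_pos κ).le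
    rw [← hk] at h
    simp only [hU]
    linarith
  have hU0 : ∀ y, 0 ≤ U y := fun y =>
    le_trans (mul_nonneg hκ.le ENNReal.toReal_nonneg) (hpt y)
  have hqp : ∀ y, IsProbabilityMeasure (q y) := by
    intro y
    obtain ⟨⟨φ, μ, τ, hφ, hτ0, h⟩, -⟩ := hq y
    rw [h]
    exact isProb_meanField φ μ τ hφ
  rw [← lintegral_const_mul' _ _ ENNReal.ofReal_ne_top]
  calc _ ≤ ∫⁻ y, ENNReal.ofReal (U y) ∂(dataDist σ2 X β) := by
        refine lintegral_mono fun y => ?_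
        dsimp only
        rw [← ENNReal.ofReal_toReal (measure_ne_top (q y) {b | m < ((config b).card : ℝ)}),
          ← ENNReal.ofReal_mul hκ.le]
        exact ENNReal.ofReal_le_ofReal (hpt y)
    _ = ENNReal.ofReal (∫ y, U y ∂(dataDist σ2 X β)) :=
        (ofReal_integral_eq_lintegral_ofReal hUi (Eventually.of_forall hU0)).symm
    _ ≤ _ := by
        refine ENNReal.ofReal_le_ofReal ?_
        have i1 : ∫ y, U y ∂(dataDist σ2 X β) = (Real.log L - 1 + Dk)
            + (∫ y, RR α σ2 a c X β (-1) y ∂(dataDist σ2 X β)) / L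
            + Real.exp κ * (ν⁻¹ * ∫ y, RR α σ2 a c X β m y ∂(dataDist σ2 X β)) := by
          have g1 : Integrable (fun y => (Real.log L - 1 + Dk) + RR α σ2 a c X β (-1) y / L)
            (dataDist σ2 X β) := (integrable_const _).add (hR1.div_const L)
          have g2 : Integrable (fun y => Real.exp κ * (ν⁻¹ * RR α σ2 a c X β m y))
            (dataDist σ2 X β) := (hA1.const_mul _).const_mul _
          simp only [hU]
          rw [integral_add g1 g2, integral_add (integrable_const _) (hR1.div_const L),
            integral_const_mul, integral_const_mul, integral_div]
          simp
        rw [i1]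
        have j1 : (∫ y, RR α σ2 a c X β (-1) y ∂(dataDist σ2 X β)) / L ≤ 1 :=
          (div_le_one hL0).2 hR2
        have j2 : Real.exp κ * (ν⁻¹ * ∫ y, RR α σ2 a c X β m y ∂(dataDist σ2 X β))
            ≤ Real.exp κ * (ν⁻¹ * LL α a c n p (config β) m) := by gcongr
        linarith

/-- Log of the inverse geometric ratio. -/
def ell (α a c : ℝ) (p : ℕ) : ℝ :=
  a * Real.log p + Real.log c - Real.log (Real.sqrt (1 / (1 - α)))

theorem exp_ell (α a c : ℝ) (hα1 : α < 1) (hc : 0 < c) (p : ℕ) (hp : 0 < p) :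
    Real.exp (-ell α a c p) = Real.sqrt (1 / (1 - α)) / (c * (p : ℝ) ^ a) := by
  have h1α : 0 < 1 - α := by linarith
  have hp' : (0 : ℝ) < p := by exact_mod_cast hp
  have hB : 0 < Real.sqrt (1 / (1 - α)) := by positivity
  have hpa : (0 : ℝ) < (p : ℝ) ^ a := Real.rpow_pos_of_pos hp' a
  rw [← Real.exp_log (show 0 < Real.sqrt (1 / (1 - α)) / (c * (p : ℝ) ^ a) by positivity),
    Real.log_div hB.ne' (by positivity), Real.log_mul hc.ne' hpa.ne', Real.log_rpow hp', ell]
  congr 1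
  ring

theorem LL_le (α a c : ℝ) (hα1 : α < 1) (hc : 0 < c) (n p : ℕ) (hp : 0 < p)
    (S0 : Finset (Fin p)) (m : ℝ) :
    LL α a c n p S0 m ≤ (priorSWt a c n p S0)⁻¹ *
      ∑ j ∈ Finset.range (p + 1), if m < (j : ℝ) then Real.exp (-ell α a c p) ^ j else 0 := by
  have h1α : 0 < 1 - α := by linarith
  have hp' : (0 : ℝ) < p := by exact_mod_cast hp
  have hB : 0 < Real.sqrt (1 / (1 - α)) := by positivity
  have hpa : (0 : ℝ) < (p : ℝ) ^ a := Real.rpow_pos_of_pos hp' a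
  have hw := wt_nonneg a c hc n p S0
  set w := priorSWt a c n p S0 with hwdef
  have h := Finset.sum_powerset_apply_card (x := (Finset.univ : Finset (Fin p))) (fun j : ℕ => if m < (j : ℝ) then
    (if j ≤ n then ((p.choose j : ℝ) * (c * (p : ℝ) ^ a) ^ j)⁻¹ else 0) / w *
      Real.sqrt (1 / (1 - α)) ^ j else 0)
  rw [Finset.powerset_univ, Finset.card_univ, Fintype.card_fin] at h
  have e : LL α a c n p S0 m = _ := h
  rw [e, Finset.mul_sum]
  refine Finset.sum_le_sum fun j hj => ?_
  have hch : (0 : ℝ) < p.choose j := by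
    exact_mod_cast Nat.choose_pos (by simpa [Nat.lt_succ_iff] using hj)
  rw [nsmul_eq_mul, exp_ell α a c hα1 hc p hp]
  split_ifs
  · refine le_of_eq ?_
    rw [div_pow]
    field_simp
  · simp only [zero_div, zero_mul, mul_zero]
    positivity
  · simp

theorem geom_le (r : ℝ) (h0 : 0 ≤ r) (h1 : r ≤ 1 / 2) (N : ℕ) :
    ∑ j ∈ Finset.range N, r ^ j ≤ 1 + 2 * r ∧ 1 + 2 * r ≤ 2 := by
  refine ⟨?_, by linarith⟩
  have h2 : ∑ j ∈ Finset.range N, r ^ j ≤ (1 - r)⁻¹ := by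
    rw [← tsum_geometric_of_lt_one h0 (by linarith)]
    exact (summable_geometric_of_lt_one h0 (by linarith)).sum_le_tsum _
      (fun i _ => by positivity)
  refine h2.trans ?_
  rw [inv_le_iff_one_le_mul₀ (by linarith)]
  nlinarith

theorem tail_le (l x : ℝ) (hl : 4 ≤ l) (N : ℕ) :
    Real.exp (l * x / 2) * ∑ j ∈ Finset.range N,
      (if x < (j : ℝ) then Real.exp (-l) ^ j else 0) ≤ 2 * Real.exp (-(l * x / 4)) := by
  have hr : Real.exp (-(l / 4)) ≤ 1 / 2 := by
    have h1 : Real.exp (-(l / 4)) ≤ Real.exp (-1) := Real.exp_le_exp.2 (by linarith)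
    have h2 : (2 : ℝ) ≤ Real.exp 1 := by linarith [Real.add_one_le_exp (1 : ℝ)]
    rw [Real.exp_neg 1] at h1
    refine h1.trans ?_
    rw [one_div]
    exact inv_anti₀ (by norm_num) h2
  have hg := geom_le _ (Real.exp_pos _).le hr N
  rw [Finset.mul_sum]
  calc _ ≤ ∑ j ∈ Finset.range N, Real.exp (-(l * x / 4)) * Real.exp (-(l / 4)) ^ j := by
        refine Finset.sum_le_sum fun j _ => ?_
        split_ifs with h
        · rw [← Real.exp_nat_mul, ← Real.exp_nat_mul, ← Real.exp_add, ← Real.exp_add]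
          refine Real.exp_le_exp.2 ?_
          nlinarith
        · rw [mul_zero]; positivity
    _ = Real.exp (-(l * x / 4)) * ∑ j ∈ Finset.range N, Real.exp (-(l / 4)) ^ j := by
        rw [Finset.mul_sum]
    _ ≤ Real.exp (-(l * x / 4)) * 2 := by
        refine mul_le_mul_of_nonneg_left (hg.1.trans hg.2) (Real.exp_pos _).le
    _ = _ := by ring

/-- The constant in the variational bound. -/
def C0 (α σ2 γ d : ℝ) : ℝ := 1 / 2 - 1 / 2 * Real.log (2 * π)
  + 1 / 2 * (Real.log (α + γ) - Real.log σ2) - 1 / 2 * Real.log d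
  - 1 / 2 * Real.log (γ / (2 * π * σ2))

theorem D_le (α σ2 γ d : ℝ) (hσ2 : 0 < σ2) (hα : 0 < α) (hγ : 0 < γ) (hd : 0 < d)
    {n p : ℕ} (hn : 0 < n) (hp2 : 2 ≤ p) (hnp : n ≤ p) (X : Matrix (Fin n) (Fin p) ℝ)
    (S : Finset (Fin p)) (hS : S.card ≤ n) (hk : 0 < S.card)
    (h : ∀ v : S → ℝ, d * (S.card : ℝ) / (p : ℝ) * sqNorm v ≤
                (n : ℝ)⁻¹ * (v ⬝ᵥ (gram X S).mulVec v)) :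
    (S.card / 2 + Real.log (∏ _j : S, (Real.sqrt (2 * π * tau α σ2 γ n S.card))⁻¹)
          - Real.log (nrm σ2 γ X S)) ≤ S.card * (2 * Real.log p + C0 α σ2 γ d) := by
  have hp' : (0 : ℝ) < p := by exact_mod_cast (by omega : 0 < p)
  have hn' : (0 : ℝ) < n := by exact_mod_cast hn
  have hn1 : (1 : ℝ) ≤ n := by exact_mod_cast hn
  have hk1 : (1 : ℝ) ≤ S.card := by exact_mod_cast hk
  have hkp : (S.card : ℝ) ≤ p := by exact_mod_cast hS.trans hnp
  have hnp' : (n : ℝ) ≤ p := by exact_mod_cast hnp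
  have hp2' : (2 : ℝ) ≤ p := by exact_mod_cast hp2
  have ht := tau_pos α σ2 γ hσ2 hα hγ n S.card
  set k := S.card with hkdef
  have hdet : (d / p) ^ k ≤ (gram X S).det := by
    refine le_trans ?_ (det_gram_ge X S (n * (d * k / p)) (by positivity) ?_)
    · refine pow_le_pow_left₀ (by positivity) ?_ _
      rw [div_eq_mul_inv, div_eq_mul_inv]
      have : 0 < d * (p : ℝ)⁻¹ := by positivity
      have h3 : (1 : ℝ) ≤ n * k := by nlinarith
      nlinarith
    · intro v
      have := mul_le_mul_of_nonneg_left (h v) hn'.le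
      rw [← mul_assoc, ← mul_assoc, mul_inv_cancel₀ hn'.ne', one_mul] at this
      exact this
  have hdp : 0 < (d / p) ^ k := by positivity
  have hdet0 := hdp.trans_le hdet
  have hlog1 : k * (Real.log d - Real.log p) ≤ Real.log (gram X S).det := by
    have := Real.log_le_log hdp hdet
    rwa [Real.log_pow, Real.log_div hd.ne' hp'.ne'] at this
  have hq : 0 < γ / (2 * π * σ2) := by positivity
  have e1 : Real.log (nrm σ2 γ X S) = 1 / 2 * (Real.log (gram X S).det
      + k * Real.log (γ / (2 * π * σ2))) := by
    rw [nrm, Real.log_sqrt (by positivity), Real.log_mul hdet0.ne' (by positivity), Real.log_pow]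
    ring
  have e2 : Real.log (∏ _j : S, (Real.sqrt (2 * π * tau α σ2 γ n k))⁻¹)
      = - (k / 2 * (Real.log (2 * π) + Real.log (tau α σ2 γ n k))) := by
    rw [Finset.prod_const, Finset.card_univ, Fintype.card_coe, Real.log_pow, Real.log_inv,
      Real.log_sqrt (by positivity), Real.log_mul (by positivity) ht.ne']
    ring
  have e3 : - Real.log (tau α σ2 γ n k) ≤ 3 * Real.log p + Real.log (α + γ) - Real.log σ2 := by
    rw [tau, Real.log_div hσ2.ne' (by positivity), Real.log_mul (by positivity) (by positivity)]
    have h4 : Real.log ((k : ℝ) * n + 1) ≤ 3 * Real.log p := by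
      have h6 : (k : ℝ) * n + 1 ≤ (p : ℝ) ^ 3 := by
        have h7 : (k : ℝ) * n ≤ p * p := mul_le_mul hkp hnp' hn'.le hp'.le
        nlinarith [mul_self_nonneg ((p : ℝ) - 1), mul_pos hp' hp']
      have := Real.log_le_log (by positivity) h6
      rw [Real.log_pow] at this
      exact_mod_cast this
    linarith
  rw [e1, e2, C0]
  nlinarith

theorem wt_inv_le (a c : ℝ) (hc : 0 < c) (n p : ℕ) (hp : 0 < p)
    (S : Finset (Fin p)) (hS : S.card ≤ n) :
    (priorSWt a c n p S)⁻¹ ≤ Real.exp (S.card * ((1 + a) * Real.log p + Real.log c)) := by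
  have hp' : (0 : ℝ) < p := by exact_mod_cast hp
  have hpa : (0 : ℝ) < (p : ℝ) ^ a := Real.rpow_pos_of_pos hp' a
  rw [priorSWt, if_pos hS, inv_inv]
  have h1 : (p.choose S.card : ℝ) ≤ (p : ℝ) ^ S.card := by exact_mod_cast Nat.choose_le_pow p S.card
  have h2 : Real.exp (S.card * ((1 + a) * Real.log p + Real.log c))
      = (p : ℝ) ^ S.card * (c * (p : ℝ) ^ a) ^ S.card := by
    rw [← mul_pow, Real.exp_nat_mul]
    congr 1
    rw [← Real.exp_log (show 0 < (p : ℝ) * (c * (p : ℝ) ^ a) by positivity),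
      Real.log_mul hp'.ne' (by positivity), Real.log_mul hc.ne' hpa.ne', Real.log_rpow hp']
    congr 1
    ring
  rw [h2]
  gcongr

theorem bound_zero (α σ2 γ a c : ℝ) (hσ2 : 0 < σ2) (hα : 0 < α) (hα1 : α < 1) (hγ : 0 < γ)
    (hc : 0 < c) {n p : ℕ} (hp : 0 < p) (X : Matrix (Fin n) (Fin p) ℝ)
    (hstd : ∀ j, ∑ i, X i j ^ 2 = (n : ℝ))
    (hns : ∀ S : Finset (Fin p), S.card ≤ n → IsUnit (gram X S).det)
    (q : (Fin n → ℝ) → Measure (Fin p → ℝ))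
    (hq : ∀ y, IsVarApprox (q y) (post α σ2 γ a c X y))
    (β : Fin p → ℝ) (hk : (config β).card = 0) (hl : 4 ≤ ell α a c p) (M : ℝ) :
    ∫⁻ y, q y {b | M * ((config β).card : ℝ) < ((config b).card : ℝ)} ∂(dataDist σ2 X β) ≤
      ENNReal.ofReal (8 * Real.exp (-ell α a c p)) := by
  have h := expect_bound α σ2 γ a c hσ2 hα hα1 hγ hc hp X hstd hns q hq β (by omega)
    (M * ((config β).card : ℝ)) 1 one_pos
  rw [ENNReal.ofReal_one, one_mul] at h
  refine h.trans (ENNReal.ofReal_le_ofReal ?_)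
  have hβ : config β = ∅ := Finset.card_eq_zero.1 hk
  have hw : priorSWt a c n p (config β) = 1 := by
    rw [priorSWt, hk]; simp
  have hL1 := LL_le α a c hα1 hc n p hp (config β) (-1)
  have hL2 := LL_le α a c hα1 hc n p hp (config β) (M * ((config β).card : ℝ))
  rw [hw, inv_one, one_mul] at hL1 hL2
  set r := Real.exp (-ell α a c p) with hr
  have hr0 : 0 < r := Real.exp_pos _
  have hr2 : r ≤ 1 / 2 := by
    have h1 : r ≤ Real.exp (-1) := Real.exp_le_exp.2 (by linarith)
    have h2 : (2 : ℝ) ≤ Real.exp 1 := by linarith [Real.add_one_le_exp (1 : ℝ)]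
    rw [Real.exp_neg 1] at h1
    refine h1.trans ?_
    rw [one_div]
    exact inv_anti₀ (by norm_num) h2
  have hg := geom_le r hr0.le hr2 (p + 1)
  have hLL0 : 0 < LL α a c n p (config β) (-1) := by
    have h1α : 0 < 1 - α := by linarith
    rw [LL]
    refine Finset.sum_pos' (fun S _ => ?_) ⟨config β, Finset.mem_univ _, ?_⟩
    · split_ifs
      · exact mul_nonneg (div_nonneg (wt_nonneg a c hc n p S) (wt_nonneg a c hc n p _))
          (by positivity)
      · exact le_rfl
    · rw [if_pos (by linarith [Nat.cast_nonneg (α := ℝ) (config β).card]), hw]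
      positivity
  have h1 : LL α a c n p (config β) (-1) ≤ 1 + 2 * r := by
    refine hL1.trans (le_trans (le_of_eq ?_) hg.1)
    refine Finset.sum_congr rfl fun j _ => ?_
    rw [if_pos (by linarith [Nat.cast_nonneg (α := ℝ) j])]
  have h2 : LL α a c n p (config β) (M * ((config β).card : ℝ)) ≤ 2 * r := by
    refine hL2.trans ?_
    rw [Finset.sum_range_succ'] at hg
    rw [Finset.sum_range_succ', hk]
    simp only [Nat.cast_zero, mul_zero, lt_self_iff_false, if_false, add_zero]
    have h3 : ∑ j ∈ Finset.range p, (if (0 : ℝ) < ((j + 1 : ℕ) : ℝ) then r ^ (j + 1) else 0)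
        = ∑ j ∈ Finset.range p, r ^ (j + 1) :=
      Finset.sum_congr rfl fun j _ => by rw [if_pos (by positivity)]
    rw [h3]
    have := hg.1
    simp only [pow_zero] at this
    linarith
  have h3 : Real.log (LL α a c n p (config β) (-1)) ≤ 2 * r := by
    have := Real.log_le_sub_one_of_pos hLL0
    linarith
  have h4 : Real.log (∏ _j : config β, (Real.sqrt (2 * π * tau α σ2 γ n (config β).card))⁻¹) = 0 := by
    rw [Finset.prod_const, Finset.card_univ, Fintype.card_coe, hk]; simp
  have h5 : Real.log (nrm σ2 γ X (config β)) = 0 := by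
    have : IsEmpty (config β) := by rw [hβ]; infer_instance
    rw [nrm, hk, Matrix.det_isEmpty]
    simp
  have h6 : Real.sqrt (γ / (α + γ)) ^ (config β).card = 1 := by rw [hk]; simp
  rw [h4, h5, h6, hk]
  have h7 : Real.exp 1 ≤ 3 := by linarith [Real.exp_one_lt_d9]
  have h8 : Real.exp 1 * (1⁻¹ * LL α a c n p (config β) (M * ((config β).card : ℝ))) ≤ 3 * (2 * r) := by
    rw [inv_one, one_mul]
    refine (mul_le_mul_of_nonneg_left h2 (Real.exp_pos _).le).trans ?_
    nlinarith
  rw [hk] at h8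
  simp only [Nat.cast_zero] at h8 ⊢
  linarith

set_option maxHeartbeats 1000000 in
theorem bound_pos (α σ2 γ a c d : ℝ) (hσ2 : 0 < σ2) (hα : 0 < α) (hα1 : α < 1) (hγ : 0 < γ)
    (ha : 0 < a) (hc : 0 < c) (hd : 0 < d) {n p : ℕ} (hn : 0 < n) (hp2 : 2 ≤ p) (hnp : n ≤ p)
    (X : Matrix (Fin n) (Fin p) ℝ)
    (hstd : ∀ j, ∑ i, X i j ^ 2 = (n : ℝ))
    (hns : ∀ S : Finset (Fin p), S.card ≤ n → IsUnit (gram X S).det)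
    (q : (Fin n → ℝ) → Measure (Fin p → ℝ))
    (hq : ∀ y, IsVarApprox (q y) (post α σ2 γ a c X y))
    (β : Fin p → ℝ) (hS : (config β).card ≤ n) (hk : 0 < (config β).card)
    (hdes : ∀ v : config β → ℝ, d * ((config β).card : ℝ) / (p : ℝ) * sqNorm v ≤
                (n : ℝ)⁻¹ * (v ⬝ᵥ (gram X (config β)).mulVec v))
    (hl : 4 ≤ ell α a c p) (M : ℝ) (hM : 8 * (2 + a) / a ≤ M)
    (hl2 : a / 2 * Real.log p ≤ ell α a c p) (hp3 : 2 ≤ Real.log p)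
    (hp4 : C0 α σ2 γ d + Real.log c + 1 ≤ Real.log p)
    (hp5 : Real.log c - Real.log (Real.sqrt (γ / (α + γ))) ≤ Real.log p) :
    ∫⁻ y, q y {b | M * ((config β).card : ℝ) < ((config b).card : ℝ)} ∂(dataDist σ2 X β) ≤
      ENNReal.ofReal (4 * (5 + a) / (a * M)) := by
  have hp : 0 < p := by omega
  have hM0 : 0 < M := lt_of_lt_of_le (by positivity) hM
  set k : ℝ := ((config β).card : ℝ) with hkdef
  have hk0 : 0 < k := by rw [hkdef]; exact_mod_cast hk
  have hk1 : 1 ≤ k := by rw [hkdef]; exact_mod_cast hk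
  set l := ell α a c p with hldef
  have hl0 : 0 < l := by linarith
  set κ := l * (M * k) / 2 with hκ
  have hκ0 : 0 < κ := by positivity
  have h := expect_bound α σ2 γ a c hσ2 hα hα1 hγ hc hp X hstd hns q hq β hS (M * k) κ hκ0
  have hL1 := LL_le α a c hα1 hc n p hp (config β) (-1)
  have hL2 := LL_le α a c hα1 hc n p hp (config β) (M * k)
  rw [← hldef] at hL1 hL2
  have hwi := wt_inv_le a c hc n p hp (config β) hS
  have hw := wt_pos a c hc n p hp (config β) hS
  set w := priorSWt a c n p (config β) with hwdef
  have h1α : 0 < 1 - α := by linarith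
  have hr2 : Real.exp (-l) ≤ 1 / 2 := by
    have h1 : Real.exp (-l) ≤ Real.exp (-1) := Real.exp_le_exp.2 (by linarith)
    have h2 : (2 : ℝ) ≤ Real.exp 1 := by linarith [Real.add_one_le_exp (1 : ℝ)]
    rw [Real.exp_neg 1] at h1
    refine h1.trans ?_
    rw [one_div]
    exact inv_anti₀ (by norm_num) h2
  have hg := geom_le _ (Real.exp_pos (-l)).le hr2 (p + 1)
  have hLL0 : 0 < LL α a c n p (config β) (-1) := by
    rw [LL]
    refine Finset.sum_pos' (fun S _ => ?_) ⟨config β, Finset.mem_univ _, ?_⟩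
    · split_ifs
      · exact mul_nonneg (div_nonneg (wt_nonneg a c hc n p S) (wt_nonneg a c hc n p _))
          (by positivity)
      · exact le_rfl
    · rw [if_pos (by linarith [Nat.cast_nonneg (α := ℝ) (config β).card])]
      positivity
  have hE0 : Real.log (LL α a c n p (config β) (-1)) ≤ k * ((1 + a) * Real.log p + Real.log c) + 1 := by
    have h1 : LL α a c n p (config β) (-1) ≤
        Real.exp (k * ((1 + a) * Real.log p + Real.log c)) * 2 := by
      refine hL1.trans (mul_le_mul hwi ?_ ?_ (Real.exp_pos _).le)
      · refine le_trans (le_of_eq ?_) (hg.1.trans hg.2)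
        refine Finset.sum_congr rfl fun j _ => ?_
        rw [if_pos (by linarith [Nat.cast_nonneg (α := ℝ) j])]
      · refine Finset.sum_nonneg fun j _ => ?_
        split_ifs
        · positivity
        · exact le_rfl
    have h2 := Real.log_le_log hLL0 h1
    rw [Real.log_mul (Real.exp_pos _).ne' (by norm_num), Real.log_exp] at h2
    have h3 := Real.log_two_lt_d9
    linarith
  have hD := D_le α σ2 γ d hσ2 hα hγ hd hn hp2 hnp X (config β) hS hk hdes
  rw [← hkdef] at hD
  have hν : 0 < Real.sqrt (γ / (α + γ)) := by positivity
  have hA : Real.exp κ * ((Real.sqrt (γ / (α + γ)) ^ (config β).card)⁻¹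
          * LL α a c n p (config β) (M * k)) ≤ 2 := by
    have hν2 : (Real.sqrt (γ / (α + γ)) ^ (config β).card)⁻¹
        = Real.exp (-(k * Real.log (Real.sqrt (γ / (α + γ))))) := by
      rw [Real.exp_neg, hkdef, Real.exp_nat_mul, Real.exp_log hν]
    have ht := tail_le l (M * k) hl (p + 1)
    rw [← hκ] at ht
    set T := ∑ j ∈ Finset.range (p + 1), (if M * k < (j : ℝ) then Real.exp (-l) ^ j else 0) with hT
    have hT0 : 0 ≤ T := by
      refine Finset.sum_nonneg fun j _ => ?_
      split_ifs
      · positivity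
      · exact le_rfl
    rw [hν2]
    calc _ ≤ Real.exp κ * (Real.exp (-(k * Real.log (Real.sqrt (γ / (α + γ))))) *
          (Real.exp (k * ((1 + a) * Real.log p + Real.log c)) * T)) := by
          have := hL2.trans (mul_le_mul_of_nonneg_right hwi hT0)
          gcongr
      _ = Real.exp (-(k * Real.log (Real.sqrt (γ / (α + γ))))) *
          Real.exp (k * ((1 + a) * Real.log p + Real.log c)) * (Real.exp κ * T) := by ring
      _ ≤ Real.exp (-(k * Real.log (Real.sqrt (γ / (α + γ))))) *
          Real.exp (k * ((1 + a) * Real.log p + Real.log c)) *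
            (2 * Real.exp (-(l * (M * k) / 4))) := by gcongr
      _ = 2 * Real.exp (k * ((1 + a) * Real.log p + (Real.log c
            - Real.log (Real.sqrt (γ / (α + γ)))) - l * M / 4)) := by
          rw [mul_comm 2, ← mul_assoc, ← Real.exp_add, ← Real.exp_add, mul_comm 2]
          congr 2
          ring
      _ ≤ 2 * 1 := by
          refine mul_le_mul_of_nonneg_left (Real.exp_le_one_iff.2 ?_) (by norm_num)
          refine mul_nonpos_of_nonneg_of_nonpos hk0.le ?_
          have h1 : a / 2 * Real.log p * M ≤ l * M := mul_le_mul_of_nonneg_right hl2 hM0.le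
          have h2 : 8 * (2 + a) ≤ M * a := (div_le_iff₀ ha).1 hM
          have h3 : 8 * (2 + a) * Real.log p ≤ M * a * Real.log p :=
            mul_le_mul_of_nonneg_right h2 (by linarith)
          nlinarith
      _ = 2 := by norm_num
  have hfin : Real.log (LL α a c n p (config β) (-1))
        + (k / 2
          + Real.log (∏ _j : config β, (Real.sqrt (2 * π * tau α σ2 γ n (config β).card))⁻¹)
          - Real.log (nrm σ2 γ X (config β)))
        + Real.exp κ * ((Real.sqrt (γ / (α + γ)) ^ (config β).card)⁻¹
          * LL α a c n p (config β) (M * k)) ≤ κ * (4 * (5 + a) / (a * M)) := by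
    have h1 : k * ((5 + a) * Real.log p) ≤ κ * (4 * (5 + a) / (a * M)) := by
      have : κ * (4 * (5 + a) / (a * M)) = k * ((5 + a) * (2 / a * l)) := by
        rw [hκ]; field_simp; ring
      rw [this]
      have h2 : Real.log p ≤ 2 / a * l := by
        have := mul_le_mul_of_nonneg_left hl2 (show 0 ≤ 2 / a by positivity)
        have e : 2 / a * (a / 2 * Real.log p) = Real.log p := by field_simp
        linarith
      gcongr
    refine le_trans ?_ h1
    have h3 := mul_le_mul_of_nonneg_left hp4 hk0.le
    have h4 : k * 2 ≤ k * Real.log p := mul_le_mul_of_nonneg_left hp3 hk0.le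
    linarith
  have h9 := h.trans (ENNReal.ofReal_le_ofReal hfin)
  rw [ENNReal.ofReal_mul hκ0.le] at h9
  exact (ENNReal.mul_le_mul_iff_right (by simpa using hκ0) ENNReal.ofReal_ne_top).1 h9

/-- **Theorem 2** (effective dimension of the variational approximation).
Under the same setup as Theorem 1, for any sequence `M n > 1` with `M n → ∞`,
`sup_{β*} E_{β*} q^n({β : |S_β| > M_n |S_{β*}|}) → 0`. -/
theorem effective_dimension
    (σ2 α γ a c d : ℝ)
    (hσ2 : 0 < σ2) (hα : α ∈ Set.Ioo (0 : ℝ) 1) (hγ : 0 < γ) (ha : 0 < a) (hc : 0 < c)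
    (hd : 0 < d)
    (p : ℕ → ℕ) (X : ∀ n : ℕ, Matrix (Fin n) (Fin (p n)) ℝ)
    (hstd : ∀ n j, ∑ i, X n i j ^ 2 = (n : ℝ))
    (hrank : ∀ n, (X n).rank = n)
    (hns : ∀ n, ∀ S : Finset (Fin (p n)), S.card ≤ n → IsUnit (gram (X n) S).det)
    (s : ℕ → ℕ)
    (hs1 : (fun n => (s n : ℝ)) =o[atTop] fun n => (n : ℝ))
    (hs2 : ∀ n, (s n : ℝ) * Real.log ((p n : ℝ) / (s n : ℝ)) < n)
    (M : ℕ → ℝ) (hM1 : ∀ n, 1 < M n) (hM : Tendsto M atTop atTop)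
    (q : ∀ n : ℕ, (Fin n → ℝ) → Measure (Fin (p n) → ℝ))
    (hq : ∀ n y, IsVarApprox (q n y) (post α σ2 γ a c (X n) y)) :
    Tendsto (fun n =>
        ⨆ β : {β : Fin (p n) → ℝ //
            (config β).card ≤ s n ∧
            ∀ v : config β → ℝ,
              d * ((config β).card : ℝ) / (p n : ℝ) * sqNorm v ≤
                (n : ℝ)⁻¹ * (v ⬝ᵥ (gram (X n) (config β)).mulVec v)},
          ∫⁻ y, q n y
              {b | M n * ((config β.1).card : ℝ) < ((config b).card : ℝ)}
            ∂ dataDist σ2 (X n) β.1)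
      atTop (𝓝 0) := by
  have hα0 := hα.1
  have hα1 := hα.2
  have hnp : ∀ n, n ≤ p n := by
    intro n
    have h := Matrix.rank_le_card_width (X n)
    rw [hrank n, Fintype.card_fin] at h
    exact h
  have hptop : Tendsto p atTop atTop := tendsto_atTop_mono hnp tendsto_id
  have hlog : Tendsto (fun n => Real.log (p n : ℝ)) atTop atTop :=
    Real.tendsto_log_atTop.comp (tendsto_natCast_atTop_atTop.comp hptop)
  have hell : Tendsto (fun n => ell α a c (p n)) atTop atTop := by
    unfold ell
    simp_rw [add_sub_assoc]
    exact tendsto_atTop_add_const_right _ _ (hlog.const_mul_atTop ha)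
  have hB1 : Tendsto (fun n => ENNReal.ofReal (8 * Real.exp (-ell α a c (p n)))
      + ENNReal.ofReal (4 * (5 + a) / (a * M n))) atTop (𝓝 0) := by
    have h1 : Tendsto (fun n => 8 * Real.exp (-ell α a c (p n))) atTop (𝓝 0) := by
      have := (Real.tendsto_exp_neg_atTop_nhds_zero.comp hell).const_mul 8
      simpa using this
    have h2 : Tendsto (fun n => 4 * (5 + a) / (a * M n)) atTop (𝓝 0) :=
      (hM.const_mul_atTop ha).const_div_atTop _
    have h3 := (ENNReal.tendsto_ofReal h1).add (ENNReal.tendsto_ofReal h2)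
    simpa using h3
  refine tendsto_of_tendsto_of_tendsto_of_le_of_le' tendsto_const_nhds hB1
    (Eventually.of_forall fun _ => zero_le) ?_
  have hsn : ∀ᶠ n in atTop, s n ≤ n := by
    filter_upwards [hs1.bound one_pos] with n hn
    simpa using hn
  filter_upwards [hsn, eventually_ge_atTop 2, hell.eventually_ge_atTop 4,
    hM.eventually_ge_atTop (8 * (2 + a) / a), hlog.eventually_ge_atTop 2,
    hlog.eventually_ge_atTop (C0 α σ2 γ d + Real.log c + 1),
    hlog.eventually_ge_atTop (Real.log c - Real.log (Real.sqrt (γ / (α + γ)))),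
    hlog.eventually_ge_atTop ((Real.log (Real.sqrt (1 / (1 - α))) - Real.log c) / (a / 2))]
    with n e1 e2 e3 e4 e5 e6 e7 e8
  have e9 : a / 2 * Real.log (p n) ≤ ell α a c (p n) := by
    rw [div_le_iff₀ (by positivity)] at e8
    rw [ell]
    linarith
  have hp2 : 2 ≤ p n := e2.trans (hnp n)
  refine iSup_le fun β => ?_
  obtain ⟨β, hβ, hdes⟩ := β
  rcases Nat.eq_zero_or_pos (config β).card with h0 | h0
  · exact (bound_zero α σ2 γ a c hσ2 hα0 hα1 hγ hc (by omega) (X n) (hstd n) (hns n) (q n) (hq n)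
      β h0 e3 (M n)).trans le_self_add
  · exact (bound_pos α σ2 γ a c d hσ2 hα0 hα1 hγ ha hc hd (by omega) hp2 (hnp n) (X n) (hstd n)
      (hns n) (q n) (hq n) β (hβ.trans e1) h0 hdes e3 (M n) e4 e9 e5 e6 e7).trans le_add_self

end VB
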